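/- arXiv:1412.2727 — 2 statements merged into one kernel-verified Lean document; each statement's English description precedes it below -/
import Mathlib

section
/- Let K and L be star-shaped bodies with respect to the origin in ℝ⁴, having countably many diameters. Assume that there exists a diameter d_K(ζ) of K containing the origin and parallel to ζ ∈ S³, such that for all subspaces w^⊥ containing ζ (w ∈ S²(ζ)) the sections K ∩ w^⊥ and L ∩ w^⊥ are directly congruent, and that these sections have no (ζ, π)-symmetries and no (u, π)-symmetries for any u ∈ ζ^⊥ ∩ w^⊥ ∩ S³. Then K = L + b or K = 𝒪L + b for some b ∈ ℝ⁴ parallel to ζ, where 𝒪 ∈ O(4) satisfies 𝒪(ζ) = ζ and 𝒪 = −I on ζ^⊥. -/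
noncomputable section

open scoped RealInnerProductSpace

/-- `ℝ⁴` as a Euclidean space. -/
abbrev E4 := EuclideanSpace ℝ (Fin 4)

/-- The unit sphere `S³` in `ℝ⁴`. -/
def sph : Set E4 := Metric.sphere (0 : E4) 1

/-- The great subsphere `S²(w) = {θ ∈ S³ : θ·w = 0}`. -/
def S2 (w : E4) : Set E4 := {θ ∈ sph | ⟪θ, w⟫ = 0}

/-- The orthogonal transformation `𝒪` determined by `ζ`: for a unit vector `ζ` the map
`x ↦ 2⟪x,ζ⟫ζ - x` satisfies `𝒪 ζ = ζ` and `𝒪 = -I` on `ζ^⊥`. -/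
def Ocal (ζ x : E4) : E4 := (2 * ⟪x, ζ⟫) • ζ - x

/-- `φ` is (the extension to `ℝ⁴` of) an element of `SO(3, S²(w))`:
a linear isometry of `ℝ⁴` fixing `w`, of determinant `1`, i.e. a rotation
of the `3`-dimensional subspace `w^⊥`. -/
def IsRot (w : E4) (φ : E4 ≃ₗᵢ[ℝ] E4) : Prop :=
  φ w = w ∧ LinearMap.det (φ.toLinearEquiv : E4 →ₗ[ℝ] E4) = 1

/-- `φ ∈ SO(3, S²(w))` is a rotation by the angle `α·π` around the axis `u ∈ S²(w)`:
it fixes `w` and `u`, and turns the plane orthogonal to `w` and `u` by the angle `α·π`. -/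
def IsRotAngleAbout (w u : E4) (α : ℝ) (φ : E4 ≃ₗᵢ[ℝ] E4) : Prop :=
  IsRot w φ ∧ φ u = u ∧
    ∀ v : E4, ⟪v, w⟫ = 0 → ⟪v, u⟫ = 0 →
      ⟪φ v, v⟫ = Real.cos (α * Real.pi) * ⟪v, v⟫

/-- A body: a compact set which is the closure of its nonempty interior. -/
def IsBody (K : Set E4) : Prop := IsCompact K ∧ (interior K).Nonempty ∧ K = closure (interior K)

/-- `K` is star-shaped with respect to the origin. -/
def StarShapedO (K : Set E4) : Prop := ∀ x ∈ K, ∀ t : ℝ, t ∈ Set.Icc (0:ℝ) 1 → t • x ∈ K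

/-- The radial function of `K`: `ρ_K(x) = max {c : c • x ∈ K}`. -/
def radialFn (K : Set E4) (x : E4) : ℝ := sSup {c : ℝ | c • x ∈ K}

/-- A star body with respect to the origin: a body, star-shaped with respect to the
origin, with continuous radial function. -/
def IsStarBody (K : Set E4) : Prop := IsBody K ∧ StarShapedO K ∧ ContinuousOn (radialFn K) sph

/-- The supremum of lengths of segments contained in `K`. -/
def chordSup (K : Set E4) : ℝ := sSup {d : ℝ | ∃ z y : E4, segment ℝ z y ⊆ K ∧ d = dist z y}

/-- A diameter of the star body `K`: a segment `[z, y] ⊆ K` of maximal length. -/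
def IsDiamStar (K : Set E4) (z y : E4) : Prop := segment ℝ z y ⊆ K ∧ dist z y = chordSup K

/-- `K` has countably many diameters. -/
def CountablyManyDiamsStar (K : Set E4) : Prop := {p : E4 × E4 | IsDiamStar K p.1 p.2}.Countable

/-- Directions of diameters of the star body `K`. -/
def starDiamDirs (K : Set E4) : Set E4 :=
  {θ ∈ sph | ∃ z y : E4, IsDiamStar K z y ∧ y - z = dist z y • θ}

/-- The section `K ∩ w^⊥`. -/
def sect (w : E4) (K : Set E4) : Set E4 := {x ∈ K | ⟪x, w⟫ = 0}

/-- Subsets `D₁`, `D₂` of `w^⊥` are directly congruent: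
`φ(D₁) = D₂ + a` for some rotation `φ ∈ SO(3, w^⊥)` and some `a ∈ w^⊥`. -/
def DirCong (w : E4) (D₁ D₂ : Set E4) : Prop :=
  ∃ φ : E4 ≃ₗᵢ[ℝ] E4, IsRot w φ ∧
    ∃ a : E4, ⟪a, w⟫ = 0 ∧ φ '' D₁ = (fun x => x + a) '' D₂

/-- The subset `D` of the `3`-dimensional subspace `w^⊥` has a `(u, π)`-symmetry. -/
def HasPiSymSet (w u : E4) (D : Set E4) : Prop :=
  ∃ φ : E4 ≃ₗᵢ[ℝ] E4, IsRotAngleAbout w u 1 φ ∧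
    ∃ a : E4, ⟪a, w⟫ = 0 ∧ φ '' D = (fun x => x + a) '' D

/-- The set `Ω^r = {w ∈ S²(ζ) : (A_K ∪ A_L) ∩ S²(w) = {±ζ}}`. -/
def OmegaR (K L : Set E4) (ζ : E4) : Set E4 :=
  {w ∈ S2 ζ | (starDiamDirs K ∪ starDiamDirs L) ∩ S2 w = {ζ, -ζ}}

open Real in
lemma wallis_mul (n : ℕ) :
    (∫ x in (0:ℝ)..π, sin x ^ (n + 1)) * (∫ x in (0:ℝ)..π, sin x ^ n) = 2 * π / (n + 1) := by
  induction n with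
  | zero => simp; ring
  | succ n ih =>
    have h := integral_sin_pow (a := 0) (b := π) (n := n)
    simp only [sin_zero, sin_pi, ne_eq, Nat.add_eq_zero_iff, one_ne_zero, and_false,
      not_false_eq_true, zero_pow, zero_mul, sub_zero, zero_div, zero_add] at h
    rw [show n + 1 + 1 = n + 2 from rfl, h, mul_assoc, mul_comm (∫ x in (0:ℝ)..π, sin x ^ n), ih]
    push_cast
    field_simp
    ring

open Real in
/-- The composition of two sine-Abel transforms is integration. -/
lemma abel_abel (k : ℝ → ℝ) (hk : Continuous k) :
    ∫ φ in (0:ℝ)..π, (∫ ψ in (0:ℝ)..π, k (sin φ * sin ψ)) * sin φ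
      = 2 * π * ∫ x in (0:ℝ)..1, k x := by
  have cin : ∀ k : ℝ → ℝ, Continuous k →
      Continuous fun φ : ℝ => (∫ ψ in (0:ℝ)..π, k (sin φ * sin ψ)) * sin φ := by
    intro k hk
    refine Continuous.mul ?_ continuous_sin
    exact intervalIntegral.continuous_parametric_intervalIntegral_of_continuous'
      (by simp only [Function.uncurry_def]; fun_prop) _ _
  have hpoly : ∀ p : Polynomial ℝ,
      ∫ φ in (0:ℝ)..π, (∫ ψ in (0:ℝ)..π, p.eval (sin φ * sin ψ)) * sin φ
        = 2 * π * ∫ x in (0:ℝ)..1, p.eval x := by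
    intro p
    induction p using Polynomial.induction_on' with
    | add p q hp hq =>
      have h1 : ∀ φ : ℝ, (∫ ψ in (0:ℝ)..π, (p + q).eval (sin φ * sin ψ)) * sin φ
          = (∫ ψ in (0:ℝ)..π, p.eval (sin φ * sin ψ)) * sin φ
            + (∫ ψ in (0:ℝ)..π, q.eval (sin φ * sin ψ)) * sin φ := by
        intro φ
        simp only [Polynomial.eval_add]
        rw [intervalIntegral.integral_add, add_mul] <;>
          exact Continuous.intervalIntegrable (by fun_prop) _ _
      simp only [h1]
      rw [intervalIntegral.integral_add ((cin _ p.continuous).intervalIntegrable _ _)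
        ((cin _ q.continuous).intervalIntegrable _ _), hp, hq]
      simp only [Polynomial.eval_add]
      rw [intervalIntegral.integral_add, mul_add] <;>
          exact Continuous.intervalIntegrable (by fun_prop) _ _
    | monomial n a =>
      have h1 : ∀ φ : ℝ, (∫ ψ in (0:ℝ)..π, (Polynomial.monomial n a).eval (sin φ * sin ψ)) * sin φ
          = (a * ∫ ψ in (0:ℝ)..π, sin ψ ^ n) * sin φ ^ (n + 1) := by
        intro φ
        simp only [Polynomial.eval_monomial, mul_pow]
        rw [intervalIntegral.integral_const_mul, intervalIntegral.integral_const_mul]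
        ring
      simp only [h1]
      simp only [Polynomial.eval_monomial]
      rw [intervalIntegral.integral_const_mul, intervalIntegral.integral_const_mul, integral_pow]
      have := wallis_mul n
      simp only [one_pow, ne_eq, Nat.add_eq_zero_iff, one_ne_zero, and_false, not_false_eq_true,
        zero_pow, sub_zero]
      linear_combination a * this
  refine eq_of_forall_dist_le fun ε hε => ?_
  set δ := ε / (π * π + 2 * π) with hδ
  have hpp : 0 < π * π + 2 * π := by positivity
  obtain ⟨p, hp⟩ := exists_polynomial_near_of_continuousOn 0 1 k hk.continuousOn δ (by positivity)
  have b1 : |(∫ φ in (0:ℝ)..π, (∫ ψ in (0:ℝ)..π, k (sin φ * sin ψ)) * sin φ)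
      - ∫ φ in (0:ℝ)..π, (∫ ψ in (0:ℝ)..π, p.eval (sin φ * sin ψ)) * sin φ| ≤ δ * π * π := by
    rw [← intervalIntegral.integral_sub ((cin _ hk).intervalIntegrable _ _)
        ((cin _ p.continuous).intervalIntegrable _ _)]
    have := intervalIntegral.norm_integral_le_of_norm_le_const (a := 0) (b := π) (C := δ * π)
      (f := fun φ => (∫ ψ in (0:ℝ)..π, k (sin φ * sin ψ)) * sin φ
        - (∫ ψ in (0:ℝ)..π, p.eval (sin φ * sin ψ)) * sin φ) ?_
    · simpa [abs_of_pos pi_pos] using this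
    · intro φ hφ
      rw [Set.uIoc_of_le pi_pos.le] at hφ
      have hs : 0 ≤ sin φ := sin_nonneg_of_mem_Icc ⟨hφ.1.le, hφ.2⟩
      rw [← sub_mul, norm_mul, ← intervalIntegral.integral_sub
        (Continuous.intervalIntegrable (by fun_prop) _ _)
        (Continuous.intervalIntegrable (by fun_prop) _ _)]
      have h2 := intervalIntegral.norm_integral_le_of_norm_le_const (a := 0) (b := π) (C := δ)
        (f := fun ψ => k (sin φ * sin ψ) - p.eval (sin φ * sin ψ)) ?_
      · rw [sub_zero, abs_of_pos pi_pos] at h2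
        calc _ ≤ δ * π * 1 := mul_le_mul h2 (by simpa using abs_sin_le_one φ) (norm_nonneg _)
              (by positivity)
          _ = _ := by ring
      · intro ψ hψ
        rw [Set.uIoc_of_le pi_pos.le] at hψ
        have hs' : 0 ≤ sin ψ := sin_nonneg_of_mem_Icc ⟨hψ.1.le, hψ.2⟩
        rw [norm_sub_rev]
        exact (hp _ ⟨by positivity, mul_le_one₀ (sin_le_one _) hs' (sin_le_one _)⟩).le
  have b2 : |(∫ x in (0:ℝ)..1, p.eval x) - ∫ x in (0:ℝ)..1, k x| ≤ δ := by
    rw [← intervalIntegral.integral_sub (Continuous.intervalIntegrable (by fun_prop) _ _)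
      (Continuous.intervalIntegrable (by fun_prop) _ _)]
    have := intervalIntegral.norm_integral_le_of_norm_le_const (a := (0:ℝ)) (b := 1) (C := δ)
      (f := fun x => p.eval x - k x) ?_
    · simpa using this
    · intro x hx
      rw [Set.uIoc_of_le zero_le_one] at hx
      exact (hp _ ⟨hx.1.le, hx.2⟩).le
  rw [Real.dist_eq]
  rw [hpoly p] at b1
  have h3 : δ * (π * π + 2 * π) = ε := by rw [hδ]; field_simp
  rw [abs_le] at *
  have hpi := pi_pos
  constructor <;> nlinarith

open Real in
lemma eq_zero_of_abel (H : ℝ → ℝ) (hH : Continuous H)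
    (h : ∀ s ∈ Set.Icc (0:ℝ) 1, ∫ ψ in (0:ℝ)..π, H (s * sin ψ) = 0) : H 1 = 0 := by
  have h1 : ∀ r ∈ Set.Icc (0:ℝ) 1, ∫ x in (0:ℝ)..r, H x = 0 := by
    intro r hr
    have e := abel_abel (fun x => H (r * x)) (by fun_prop)
    have z : ∫ φ in (0:ℝ)..π, (∫ ψ in (0:ℝ)..π, H (r * (sin φ * sin ψ))) * sin φ = 0 := by
      refine (intervalIntegral.integral_congr (g := fun _ => (0:ℝ)) fun φ hφ => ?_).trans
        intervalIntegral.integral_zero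
      rw [Set.uIcc_of_le pi_pos.le] at hφ
      have hs : 0 ≤ sin φ := sin_nonneg_of_mem_Icc hφ
      have := h (r * sin φ) ⟨mul_nonneg hr.1 hs, mul_le_one₀ hr.2 hs (sin_le_one _)⟩
      simp only [mul_assoc] at this
      simp [this]
    rw [z] at e
    have e2 : ∫ x in (0:ℝ)..1, H (r * x) = 0 := by
      have := pi_pos
      rcases mul_eq_zero.1 e.symm with h | h
      · nlinarith
      · exact h
    have := intervalIntegral.mul_integral_comp_mul_left (a := 0) (b := 1) (f := H) r
    rw [e2] at this
    simpa using this.symm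
  have h2 : ∀ r ∈ Set.Ioo (0:ℝ) 1, H r = 0 := by
    intro r hr
    have d := hH.deriv_integral H 0 r
    rw [← d]
    have : (fun b => ∫ x in (0:ℝ)..b, H x) =ᶠ[nhds r] fun _ => 0 := by
      filter_upwards [Ioo_mem_nhds hr.1 hr.2] with b hb
      exact h1 b ⟨hb.1.le, hb.2.le⟩
    rw [this.deriv_eq]; simp
  have h3 : Set.EqOn H (fun _ => 0) (closure (Set.Ioo (0:ℝ) 1)) :=
    Set.EqOn.closure h2 hH continuous_const
  exact h3 (by rw [closure_Ioo (by norm_num)]; simp)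

section Frames

variable {E : Type*} [NormedAddCommGroup E] [InnerProductSpace ℝ E]

open Real

/-- The arc-length parametrisation of the great circle through `u` and `v`. -/
def circ (u v : E) (t : ℝ) : E := cos t • u + sin t • v

/-- `(u, v)` is an orthonormal pair. -/
def IsFrame (u v : E) : Prop := ‖u‖ = 1 ∧ ‖v‖ = 1 ∧ ⟪u, v⟫ = 0

lemma circ_zero (u v : E) : circ u v 0 = u := by simp [circ]

lemma circ_pi_div_two (u v : E) : circ u v (π / 2) = v := by simp [circ]

lemma circ_add_pi (u v : E) (t : ℝ) : circ u v (t + π) = -circ u v t := by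
  simp [circ, cos_add_pi, sin_add_pi]; abel

lemma circ_periodic (u v : E) : Function.Periodic (circ u v) (2 * π) := by
  intro t; simp [circ]

lemma circ_neg_right (u v : E) (t : ℝ) : circ u (-v) t = circ u v (-t) := by
  simp [circ]

lemma circ_add (u v : E) (s t : ℝ) :
    circ u v (s + t) = cos t • circ u v s + sin t • circ u v (s + π / 2) := by
  simp only [circ, cos_add, sin_add, cos_pi_div_two, sin_pi_div_two]
  module

lemma circ_circ (u v : E) (s t : ℝ) :
    circ (circ u v s) (circ u v (s + π / 2)) t = circ u v (s + t) := by
  rw [circ_add u v s t]; rfl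

@[fun_prop]
lemma continuous_circ {X : Type*} [TopologicalSpace X] {f g : X → E} {t : X → ℝ}
    (hf : Continuous f) (hg : Continuous g) (ht : Continuous t) :
    Continuous fun x => circ (f x) (g x) (t x) := by
  unfold circ; fun_prop

namespace IsFrame

variable {u v : E}

lemma inner_self_left (h : IsFrame u v) : ⟪u, u⟫ = 1 := by
  rw [real_inner_self_eq_norm_sq, h.1]; norm_num

lemma inner_self_right (h : IsFrame u v) : ⟪v, v⟫ = 1 := by
  rw [real_inner_self_eq_norm_sq, h.2.1]; norm_num

lemma inner_left_right (h : IsFrame u v) : ⟪u, v⟫ = 0 := h.2.2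

lemma inner_right_left (h : IsFrame u v) : ⟪v, u⟫ = 0 := by
  rw [real_inner_comm]; exact h.2.2

lemma of_inner (h1 : ⟪u, u⟫ = 1) (h2 : ⟪v, v⟫ = 1) (h3 : ⟪u, v⟫ = 0) : IsFrame u v := by
  rw [real_inner_self_eq_norm_sq] at h1 h2
  exact ⟨by nlinarith [norm_nonneg u], by nlinarith [norm_nonneg v], h3⟩

lemma inner_comb (h : IsFrame u v) (a b c d : ℝ) :
    ⟪a • u + b • v, c • u + d • v⟫ = a * c + b * d := by
  simp only [inner_add_left, inner_add_right, real_inner_smul_left, real_inner_smul_right,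
    h.inner_self_left, h.inner_self_right, h.inner_left_right, h.inner_right_left]
  ring

lemma inner_circ (h : IsFrame u v) (s t : ℝ) : ⟪circ u v s, circ u v t⟫ = cos (s - t) := by
  rw [circ, circ, h.inner_comb, cos_sub]

lemma norm_circ (h : IsFrame u v) (t : ℝ) : ‖circ u v t‖ = 1 := by
  have := h.inner_circ t t
  rw [real_inner_self_eq_norm_sq, sub_self, cos_zero] at this
  nlinarith [norm_nonneg (circ u v t)]

lemma rotate (h : IsFrame u v) (s : ℝ) : IsFrame (circ u v s) (circ u v (s + π / 2)) :=
  ⟨h.norm_circ _, h.norm_circ _, by rw [h.inner_circ]; simp⟩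

lemma neg_right (h : IsFrame u v) : IsFrame u (-v) := by
  refine ⟨h.1, by simpa using h.2.1, by simpa using h.2.2⟩

lemma mul_circ {w : E} (hu : ⟪w, u⟫ = 0) (hv : ⟪w, v⟫ = 0) (t : ℝ) : ⟪w, circ u v t⟫ = 0 := by
  simp [circ, inner_add_right, real_inner_smul_right, hu, hv]

end IsFrame

lemma exists_polar (x y : ℝ) :
    ∃ δ, x = √(x ^ 2 + y ^ 2) * cos δ ∧ y = √(x ^ 2 + y ^ 2) * sin δ := by
  refine ⟨Complex.arg ⟨x, y⟩, ?_⟩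
  have h : √(x ^ 2 + y ^ 2) = ‖(⟨x, y⟩ : ℂ)‖ := by
    rw [Complex.norm_def, Complex.normSq_mk]; ring_nf
  rw [h, Complex.norm_mul_cos_arg, Complex.norm_mul_sin_arg]
  exact ⟨rfl, rfl⟩

variable [FiniteDimensional ℝ E]

lemma exists_unit_orth (hE : 3 ≤ Module.finrank ℝ E) (x y : E) :
    ∃ w : E, ‖w‖ = 1 ∧ ⟪w, x⟫ = 0 ∧ ⟪w, y⟫ = 0 := by
  set S := Submodule.span ℝ {x, y}
  have h1 : Module.finrank ℝ S ≤ 2 := by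
    classical
    have := finrank_span_finset_le_card (R := ℝ) ({x, y} : Finset E)
    rw [Finset.coe_pair] at this
    exact this.trans Finset.card_le_two
  have h2 := S.finrank_add_finrank_orthogonal
  have h3 : Sᗮ ≠ ⊥ := by
    intro h
    rw [h, finrank_bot] at h2
    omega
  obtain ⟨z, hz, hz0⟩ := Sᗮ.ne_bot_iff.1 h3
  rw [Submodule.mem_orthogonal'] at hz
  have hx := hz x (Submodule.subset_span (by simp))
  have hy := hz y (Submodule.subset_span (by simp))
  refine ⟨‖z‖⁻¹ • z,
    by rw [norm_smul, norm_inv, norm_norm, inv_mul_cancel₀ (norm_ne_zero_iff.2 hz0)],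
    by simp [real_inner_smul_left, hx], by simp [real_inner_smul_left, hy]⟩

lemma exists_frame_orth (hE : 3 ≤ Module.finrank ℝ E) (p : E) :
    ∃ e₁ e₂ : E, IsFrame e₁ e₂ ∧ ⟪p, e₁⟫ = 0 ∧ ⟪p, e₂⟫ = 0 := by
  obtain ⟨e₁, h1, h2, -⟩ := exists_unit_orth hE p p
  obtain ⟨e₂, k1, k2, k3⟩ := exists_unit_orth hE p e₁
  exact ⟨e₁, e₂, ⟨h1, k1, by rwa [real_inner_comm]⟩, by rwa [real_inner_comm],
    by rwa [real_inner_comm]⟩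

/-- Any two unit vectors lie on a common great circle. -/
lemma exists_frame_through (hE : 3 ≤ Module.finrank ℝ E) {x y : E} (hx : ‖x‖ = 1) (hy : ‖y‖ = 1) :
    ∃ v t, IsFrame x v ∧ circ x v t = y := by
  have hxx : ⟪x, x⟫ = 1 := by rw [real_inner_self_eq_norm_sq, hx]; norm_num
  have hyy : ⟪y, y⟫ = 1 := by rw [real_inner_self_eq_norm_sq, hy]; norm_num
  set c := ⟪x, y⟫ with hc
  have hyx : ⟪y, x⟫ = c := by rw [real_inner_comm]
  set r := y - c • x with hr
  have hxr : ⟪x, r⟫ = 0 := by rw [hr, inner_sub_right, real_inner_smul_right, hxx, ← hc]; ring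
  have hrr : ⟪r, r⟫ = 1 - c ^ 2 := by
    rw [hr]
    simp only [inner_sub_left, inner_sub_right, real_inner_smul_left, real_inner_smul_right,
      hxx, hyy, hyx, ← hc]
    ring
  have hn : ‖r‖ ^ 2 = 1 - c ^ 2 := by rw [← real_inner_self_eq_norm_sq, hrr]
  obtain ⟨δ, h1, h2⟩ := exists_polar c ‖r‖
  rw [show c ^ 2 + ‖r‖ ^ 2 = 1 by rw [hn]; ring, sqrt_one, one_mul] at h1 h2
  by_cases h0 : r = 0
  · obtain ⟨v, hv, hvx, -⟩ := exists_unit_orth hE x x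
    refine ⟨v, δ, ⟨hx, hv, by rwa [real_inner_comm]⟩, ?_⟩
    rw [h0, norm_zero] at h2
    rw [circ, ← h1, ← h2, zero_smul, add_zero]
    rw [hr, sub_eq_zero] at h0
    exact h0.symm
  · have hr0 : ‖r‖ ≠ 0 := norm_ne_zero_iff.2 h0
    refine ⟨‖r‖⁻¹ • r, δ, ⟨hx, by rw [norm_smul, norm_inv, norm_norm, inv_mul_cancel₀ hr0],
      by rw [real_inner_smul_right, hxr, mul_zero]⟩, ?_⟩
    rw [circ, ← h1, ← h2, smul_smul, mul_inv_cancel₀ hr0, one_smul, hr]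
    abel

lemma integral_swap_interval {f : ℝ → ℝ → ℝ} (hf : Continuous (Function.uncurry f)) {a b c d : ℝ}
    (hab : a ≤ b) (hcd : c ≤ d) :
    ∫ x in a..b, ∫ y in c..d, f x y = ∫ y in c..d, ∫ x in a..b, f x y := by
  simp only [intervalIntegral.integral_of_le hab, intervalIntegral.integral_of_le hcd]
  refine MeasureTheory.integral_integral_swap ?_
  rw [MeasureTheory.Measure.prod_restrict]
  refine MeasureTheory.IntegrableOn.mono_set (t := Set.Icc a b ×ˢ Set.Icc c d) ?_
    (Set.prod_mono Set.Ioc_subset_Icc_self Set.Ioc_subset_Icc_self)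
  exact hf.continuousOn.integrableOn_compact (isCompact_Icc.prod isCompact_Icc)

/-- The Minkowski-Funk theorem: an even continuous function whose integrals over all great circles
vanish is zero on the unit sphere. -/
lemma eq_zero_of_funk (hE : 3 ≤ Module.finrank ℝ E) {h : E → ℝ} (hc : Continuous h)
    (heven : ∀ x, h (-x) = h x)
    (hzero : ∀ u v : E, IsFrame u v → ∫ t in (0:ℝ)..(2 * π), h (circ u v t) = 0)
    {p : E} (hp : ‖p‖ = 1) : h p = 0 := by
  obtain ⟨e₁, e₂, he, hp1, hp2⟩ := exists_frame_orth hE p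
  have hpp : ⟪p, p⟫ = 1 := by rw [real_inner_self_eq_norm_sq, hp]; norm_num
  have h2p : (0:ℝ) ≤ 2 * π := by positivity
  set H : ℝ → ℝ := fun c => ∫ φ in (0:ℝ)..(2 * π), h (c • p + √(1 - c ^ 2) • circ e₁ e₂ φ) with hH
  have hHc : Continuous H :=
    intervalIntegral.continuous_parametric_intervalIntegral_of_continuous'
      (by simp only [Function.uncurry_def]; fun_prop) _ _
  have per : ∀ c r δ : ℝ, ∫ φ in (0:ℝ)..(2 * π), h (c • p + r • circ e₁ e₂ (φ + δ))
      = ∫ φ in (0:ℝ)..(2 * π), h (c • p + r • circ e₁ e₂ φ) := by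
    intro c r δ
    rw [intervalIntegral.integral_comp_add_right (fun φ => h (c • p + r • circ e₁ e₂ φ)) δ,
      zero_add, add_comm]
    have hper : Function.Periodic (fun φ => h (c • p + r • circ e₁ e₂ φ)) (2 * π) := by
      intro φ; simp only [circ_periodic e₁ e₂ φ]
    simpa using hper.intervalIntegral_add_eq δ 0
  have hHe : ∀ c, H (-c) = H c := by
    intro c
    simp only [hH]
    rw [← per (-c) _ π]
    refine intervalIntegral.integral_congr fun φ _ => ?_
    simp only [circ_add_pi, neg_sq]
    rw [← heven]
    congr 1
    module
  have key : ∀ s ∈ Set.Icc (0:ℝ) 1, ∫ ψ in (0:ℝ)..(2 * π), H (s * sin ψ) = 0 := by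
    intro s hs
    have hs2 : 0 ≤ 1 - s ^ 2 := by nlinarith [hs.1, hs.2]
    set V : ℝ → E := fun φ => s • p + √(1 - s ^ 2) • circ e₁ e₂ (φ + π / 2) with hV
    have hfr : ∀ φ, IsFrame (circ e₁ e₂ φ) (V φ) := by
      intro φ
      have a1 : ⟪p, circ e₁ e₂ (φ + π / 2)⟫ = 0 := IsFrame.mul_circ hp1 hp2 _
      have a2 : ⟪p, circ e₁ e₂ φ⟫ = 0 := IsFrame.mul_circ hp1 hp2 _
      have F : IsFrame p (circ e₁ e₂ (φ + π / 2)) := ⟨hp, he.norm_circ _, a1⟩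
      refine IsFrame.of_inner ?_ ?_ ?_
      · rw [he.inner_circ]; simp
      · rw [hV, F.inner_comb]; nlinarith [mul_self_sqrt hs2]
      · rw [hV, inner_add_right, real_inner_smul_right, real_inner_smul_right, real_inner_comm, a2,
          he.inner_circ]
        simp
    have e1 : ∀ ψ, H (s * sin ψ) = ∫ φ in (0:ℝ)..(2 * π), h (circ (circ e₁ e₂ φ) (V φ) ψ) := by
      intro ψ
      obtain ⟨δ, d1, d2⟩ := exists_polar (cos ψ) (√(1 - s ^ 2) * sin ψ)
      have hR : cos ψ ^ 2 + (√(1 - s ^ 2) * sin ψ) ^ 2 = 1 - (s * sin ψ) ^ 2 := by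
        rw [mul_pow, sq_sqrt hs2, cos_sq']; ring
      rw [hR] at d1 d2
      simp only [hH]
      rw [← per _ _ δ]
      refine intervalIntegral.integral_congr fun φ _ => ?_
      congr 1
      rw [circ_add e₁ e₂ φ δ, circ.eq_def (circ e₁ e₂ φ), hV]
      simp only [smul_add, smul_smul]
      rw [← d1, ← d2, mul_comm (sin ψ) √(1 - s ^ 2), mul_comm s]
      abel
    simp only [e1]
    rw [integral_swap_interval (by simp only [Function.uncurry_def, hV]; fun_prop) h2p h2p]
    simp only [hzero _ _ (hfr _)]
    simp
  have key2 : ∀ s ∈ Set.Icc (0:ℝ) 1, ∫ ψ in (0:ℝ)..π, H (s * sin ψ) = 0 := by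
    intro s hs
    have k := key s hs
    have ci : ∀ a b, IntervalIntegrable (fun ψ => H (s * sin ψ)) MeasureTheory.volume a b :=
      fun a b => Continuous.intervalIntegrable (by fun_prop) _ _
    rw [← intervalIntegral.integral_add_adjacent_intervals (ci 0 π) (ci π (2 * π))] at k
    have e : ∫ ψ in π..(2 * π), H (s * sin ψ) = ∫ ψ in (0:ℝ)..π, H (s * sin ψ) := by
      have := intervalIntegral.integral_comp_add_right (a := 0) (b := π)
        (fun ψ => H (s * sin ψ)) π
      rw [zero_add, ← two_mul] at this
      rw [← this]
      refine intervalIntegral.integral_congr fun φ _ => ?_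
      simp only [sin_add_pi, mul_neg, hHe]
    rw [e] at k
    linarith
  have h1 := eq_zero_of_abel H hHc key2
  simp only [hH] at h1
  simpa [pi_ne_zero] using h1

end Frames

section Zigzag

open Real Filter Topology

/-- The group of periods of a real function. -/
def periodGroup (p : ℝ → ℝ) : AddSubgroup ℝ where
  carrier := {c | ∀ t, p (t + c) = p t}
  zero_mem' := by simp
  add_mem' := by
    intro a b ha hb t
    rw [← add_assoc, hb, ha]
  neg_mem' := by
    intro a ha t
    have := ha (t + -a)
    rw [neg_add_cancel_right] at this
    exact this.symm

lemma mem_periodGroup {p : ℝ → ℝ} {c : ℝ} : c ∈ periodGroup p ↔ ∀ t, p (t + c) = p t := Iff.rfl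

lemma const_of_dense_periods {p : ℝ → ℝ} (hp : Continuous p)
    (hd : Dense (periodGroup p : Set ℝ)) (s t : ℝ) : p s = p t := by
  have h : p = fun _ => p 0 := by
    refine Continuous.ext_on hd hp continuous_const fun c hc => ?_
    simpa using mem_periodGroup.1 hc 0
  rw [h]

lemma const_of_small_periods {p : ℝ → ℝ} (hp : Continuous p)
    (h : ∀ ε > 0, ∃ c, 0 < |c| ∧ |c| < ε ∧ ∀ t, p (t + c) = p t) (s t : ℝ) : p s = p t := by
  refine const_of_dense_periods hp (AddSubgroup.dense_of_not_isolated_zero _ fun ε hε => ?_) s t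
  obtain ⟨c, h1, h2, h3⟩ := h ε hε
  refine ⟨|c|, ?_, h1, h2⟩
  rcases abs_choice c with e | e <;> rw [e]
  · exact h3
  · exact (periodGroup p).neg_mem h3

lemma eq_zero_of_antiperiodic {o : ℝ → ℝ} (hc : Continuous o) (ha : ∀ t, o (t + π) = -o t)
    (hconst : ∀ s t, o s ^ 2 = o t ^ 2) (t : ℝ) : o t = 0 := by
  obtain ⟨s, hs⟩ : ∃ s, o s = 0 := by
    have h1 := ha 0
    rw [zero_add] at h1
    rcases le_total (o 0) 0 with h | h
    · obtain ⟨s, -, hs⟩ := intermediate_value_Icc pi_pos.le hc.continuousOn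
        (show (0:ℝ) ∈ Set.Icc (o 0) (o π) from ⟨h, by linarith⟩)
      exact ⟨s, hs⟩
    · obtain ⟨s, -, hs⟩ := intermediate_value_Icc' pi_pos.le hc.continuousOn
        (show (0:ℝ) ∈ Set.Icc (o π) (o 0) from ⟨by linarith, h⟩)
      exact ⟨s, hs⟩
  have := hconst t s
  rw [hs] at this
  simpa using this

variable {E : Type*} [NormedAddCommGroup E] [InnerProductSpace ℝ E]

/-- The vector with coordinates `a, b, c` in the rotated frame at `t` completed by `w`. -/
def frameComb (u v w : E) (t a b c : ℝ) : E :=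
  a • circ u v t + b • circ u v (t + π / 2) + c • w

lemma norm_frameComb_le {u v w : E} (h : IsFrame u v) (hw : ‖w‖ = 1) (t a b c : ℝ) :
    ‖frameComb u v w t a b c‖ ≤ |a| + |b| + |c| := by
  refine (norm_add₃_le).trans ?_
  simp [norm_smul, h.norm_circ, hw]

lemma inner_frameComb {u v w : E} (h : IsFrame u v) (hw : ‖w‖ = 1) (hu : ⟪w, u⟫ = 0)
    (hv : ⟪w, v⟫ = 0) (t a b c a' b' c' : ℝ) :
    ⟪frameComb u v w t a b c, frameComb u v w t a' b' c'⟫ = a * a' + b * b' + c * c' := by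
  have hww : ⟪w, w⟫ = 1 := by rw [real_inner_self_eq_norm_sq, hw]; norm_num
  have h1 : ∀ t, ⟪w, circ u v t⟫ = 0 := IsFrame.mul_circ hu hv
  have h2 : ∀ t, ⟪circ u v t, w⟫ = 0 := fun t => by rw [real_inner_comm]; exact h1 t
  simp only [frameComb, inner_add_left, inner_add_right, real_inner_smul_left,
    real_inner_smul_right, h.inner_circ, h1, h2, hww]
  simp
  ring

lemma frameComb_of_near {P : E → ℝ} {u₀ v₀ w : E} (h : IsFrame u₀ v₀) (hw : ‖w‖ = 1)
    (hu : ⟪w, u₀⟫ = 0) (hv : ⟪w, v₀⟫ = 0) {α ε : ℝ}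
    (H : ∀ s u v, IsFrame u v → ‖u - circ u₀ v₀ s‖ < ε → ‖v - circ u₀ v₀ (s + π / 2)‖ < ε →
      P (circ u v α) = P u)
    (t r a b c a' b' c' : ℝ) (h1 : a * a + b * b + c * c = 1) (h2 : a' * a' + b' * b' + c' * c' = 1)
    (h3 : a * a' + b * b' + c * c' = 0) (h4 : |a - cos r| + |b - sin r| + |c| < ε)
    (h5 : |a' + sin r| + |b' - cos r| + |c'| < ε) :
    P (frameComb u₀ v₀ w t (cos α * a + sin α * a') (cos α * b + sin α * b')
      (cos α * c + sin α * c')) = P (frameComb u₀ v₀ w t a b c) := by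
  rw [← H (t + r) (frameComb u₀ v₀ w t a b c) (frameComb u₀ v₀ w t a' b' c')]
  · congr 1
    simp only [circ, frameComb]
    module
  · apply IsFrame.of_inner <;> rwa [inner_frameComb h hw hu hv]
  · refine lt_of_le_of_lt ?_ h4
    have e : frameComb u₀ v₀ w t a b c - circ u₀ v₀ (t + r)
        = frameComb u₀ v₀ w t (a - cos r) (b - sin r) c := by
      rw [circ_add u₀ v₀ t r, frameComb, frameComb]
      module
    rw [e]
    exact norm_frameComb_le h hw ..
  · refine lt_of_le_of_lt ?_ h5
    have e : frameComb u₀ v₀ w t a' b' c' - circ u₀ v₀ (t + r + π / 2)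
        = frameComb u₀ v₀ w t (a' + sin r) (b' - cos r) c' := by
      rw [add_assoc, circ_add u₀ v₀ t (r + π / 2), cos_add_pi_div_two, sin_add_pi_div_two,
        frameComb, frameComb]
      module
    rw [e]
    exact norm_frameComb_le h hw ..

lemma eventually_lt_of_continuousAt {f : ℝ → ℝ} (hf : ContinuousAt f 0) (h0 : f 0 = 0) {ε : ℝ}
    (hε : 0 < ε) : ∀ᶠ e in 𝓝 0, f e < ε :=
  hf.eventually_lt continuousAt_const (by rwa [h0])

lemma const_of_zigzag_of_cos_eq_zero [FiniteDimensional ℝ E] (hE : 3 ≤ Module.finrank ℝ E)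
    {P : E → ℝ}
    (hP : Continuous P) (heven : ∀ x, P (-x) = P x) {u₀ v₀ : E} (h : IsFrame u₀ v₀) {α ε : ℝ}
    (hc : cos α = 0) (hε : 0 < ε)
    (H : ∀ s u v, IsFrame u v → ‖u - circ u₀ v₀ s‖ < ε → ‖v - circ u₀ v₀ (s + π / 2)‖ < ε →
      P (circ u v α) = P u) (s t : ℝ) : P (circ u₀ v₀ s) = P (circ u₀ v₀ t) := by
  obtain ⟨w, hw, hu, hv⟩ := exists_unit_orth hE u₀ v₀
  have near := frameComb_of_near h hw hu hv H
  have hα2 : sin α * sin α = 1 - cos α * cos α := by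
    nlinarith [sin_sq_add_cos_sq α]
  refine const_of_small_periods (p := fun t => P (circ u₀ v₀ t)) (by fun_prop)
    (fun ε' hε' => ?_) s t
  have hper : ∀ t, P (circ u₀ v₀ (t + α)) = P (circ u₀ v₀ t) := by
    intro t
    have := H t (circ u₀ v₀ t) (circ u₀ v₀ (t + π / 2)) (h.rotate t) (by simpa) (by simpa)
    rwa [circ_circ] at this
  have hs : sin α = 1 ∨ sin α = -1 := by
    rw [hc] at hα2
    have : (sin α - 1) * (sin α + 1) = 0 := by linarith
    rcases mul_eq_zero.1 this with h | h
    · left; linarith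
    · right; linarith
  have near' : ∀ t a b c a' b' c' : ℝ, a * a + b * b + c * c = 1 → a' * a' + b' * b' + c' * c' = 1 →
      a * a' + b * b' + c * c' = 0 → |a - 1| + |b| + |c| < ε → |a'| + |b' - 1| + |c'| < ε →
      P (frameComb u₀ v₀ w t a' b' c') = P (frameComb u₀ v₀ w t a b c) := by
    intro t a b c a' b' c' h1 h2 h3 h4 h5
    rw [← near t 0 a b c a' b' c' h1 h2 h3 (by simpa using h4) (by simpa using h5), hc]
    rcases hs with hs | hs <;> rw [hs]
    · simp
    · rw [← heven]
      congr 1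
      simp only [frameComb]
      module
  have lift : ∀ t a b, a * a + b * b = 1 → |a - 1| + |b| < ε →
      P (frameComb u₀ v₀ w t a 0 b) = P (circ u₀ v₀ t) := by
    intro t a b h1 h2
    rw [← near' t a 0 b 0 1 0 (by linarith) (by simp) (by simp) (by simpa using h2) (by simpa),
      near' t 1 0 0 0 1 0 (by simp) (by simp) (by simp) (by simpa) (by simpa)]
    simp [frameComb]
  have quarter : ∀ t, P (circ u₀ v₀ (t + π / 2)) = P (circ u₀ v₀ t) := by
    intro t
    have := near' t 1 0 0 0 1 0 (by simp) (by simp) (by simp) (by simpa) (by simpa)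
    simpa [frameComb] using this
  set x : ℝ → ℝ := fun e => sin e ^ 2 / cos e
  set R : ℝ → ℝ := fun e => cos e * √(1 + x e ^ 2)
  have hxc : ContinuousAt x 0 := ContinuousAt.div (by fun_prop) (by fun_prop) (by simp)
  have hx0 : x 0 = 0 := by simp [x]
  have hRc : ContinuousAt R 0 := by fun_prop
  have hR0 : R 0 = 1 := by simp [R, hx0]
  have ev : ∀ᶠ e in 𝓝[>] (0:ℝ), 0 < e ∧ e < π / 2 ∧ arctan (x e) < ε' ∧
      |cos e - 1| + |sin e| < ε ∧
      |-(sin e ^ 2)| + |cos e - 1| + |sin e * cos e| < ε ∧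
      |R e - 1| + |sin e * cos e| < ε := by
    refine Filter.Eventually.and (eventually_mem_nhdsWithin) (Filter.Eventually.filter_mono
      nhdsWithin_le_nhds ?_)
    refine (eventually_lt_nhds (by positivity)).and ((eventually_lt_of_continuousAt
      (by fun_prop) (by simp [hx0]) hε').and ((eventually_lt_of_continuousAt
      (by fun_prop) (by simp) hε).and ((eventually_lt_of_continuousAt
      (by fun_prop) (by simp) hε).and (eventually_lt_of_continuousAt
      (by fun_prop) (by simp [hR0]) hε))))
  obtain ⟨e, e1, e2, e3, e4, e5, e6⟩ := ev.exists
  have hce : 0 < cos e := cos_pos_of_mem_Ioo ⟨by linarith, e2⟩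
  have hse : 0 < sin e := sin_pos_of_pos_of_lt_pi e1 (by linarith)
  have hx : 0 < x e := by positivity
  have hδ : 0 < arctan (x e) := arctan_pos.2 hx
  have hsq : 0 < √(1 + x e ^ 2) := by positivity
  have r1 : R e * cos (arctan (x e)) = cos e := by
    rw [cos_arctan]; simp only [R]; field_simp
  have r2 : R e * sin (arctan (x e)) = sin e ^ 2 := by
    rw [sin_arctan]; simp only [R, x]; field_simp
  have hsc := sin_sq_add_cos_sq e
  have r3 : R e * R e + (sin e * cos e) * (sin e * cos e) = 1 := by
    have h0 := sin_sq_add_cos_sq (arctan (x e))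
    have : R e * R e = cos e ^ 2 + (sin e ^ 2) ^ 2 := by
      linear_combination -(R e * R e) * h0 + (R e * cos (arctan (x e)) + cos e) * r1
        + (R e * sin (arctan (x e)) + sin e ^ 2) * r2
    rw [this]
    linear_combination (sin e ^ 2 + 1) * hsc
  refine ⟨arctan (x e), abs_pos.2 hδ.ne', by rwa [abs_of_pos hδ], fun t => ?_⟩
  have s1 := lift t (cos e) (sin e) (by nlinarith) e4
  have s2 := near' t (cos e) 0 (sin e) (-(sin e ^ 2)) (cos e) (sin e * cos e) (by nlinarith)
    (by linear_combination (sin e ^ 2 + 1) * hsc) (by ring) (by simpa using e4) e5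
  have s3 := lift (t + arctan (x e) + π / 2) (R e) (sin e * cos e) r3 e6
  rw [quarter] at s3
  change P _ = P _
  rw [← s3, ← s1, ← s2]
  congr 1
  rw [← r2, ← r1]
  simp only [frameComb]
  rw [add_assoc t, add_comm (arctan _), ← add_assoc t,
    circ_add u₀ v₀ (t + π / 2), add_assoc t (π / 2), add_halves, circ_add_pi]
  module

lemma const_of_zigzag_of_cos_ne_zero [FiniteDimensional ℝ E] (hE : 3 ≤ Module.finrank ℝ E)
    {P : E → ℝ}
    (hP : Continuous P) {u₀ v₀ : E} (h : IsFrame u₀ v₀) {α ε : ℝ}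
    (hα : sin α ≠ 0) (hc : cos α ≠ 0) (hε : 0 < ε)
    (H : ∀ s u v, IsFrame u v → ‖u - circ u₀ v₀ s‖ < ε → ‖v - circ u₀ v₀ (s + π / 2)‖ < ε →
      P (circ u v α) = P u) (s t : ℝ) : P (circ u₀ v₀ s) = P (circ u₀ v₀ t) := by
  obtain ⟨w, hw, hu, hv⟩ := exists_unit_orth hE u₀ v₀
  have near := frameComb_of_near h hw hu hv H
  have hα2 : sin α * sin α = 1 - cos α * cos α := by
    nlinarith [sin_sq_add_cos_sq α]
  refine const_of_small_periods (p := fun t => P (circ u₀ v₀ t)) (by fun_prop)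
    (fun ε' hε' => ?_) s t
  have hper : ∀ t, P (circ u₀ v₀ (t + α)) = P (circ u₀ v₀ t) := by
    intro t
    have := H t (circ u₀ v₀ t) (circ u₀ v₀ (t + π / 2)) (h.rotate t) (by simpa) (by simpa)
    rwa [circ_circ] at this
  set R : ℝ → ℝ := fun e => cos α / cos (α + e)
  set k : ℝ → ℝ := fun e => √(1 - R e ^ 2)
  have hRc : ContinuousAt R 0 := ContinuousAt.div (by fun_prop) (by fun_prop) (by simpa)
  have hR0 : R 0 = 1 := by simp [R, hc]
  have hk0 : k 0 = 0 := by simp [k, hR0]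
  have hkc : ContinuousAt k 0 := by fun_prop
  have h2α : sin (2 * α) ≠ 0 := by rw [sin_two_mul]; simp [hα, hc]
  have ev0 : ∀ᶠ e in 𝓝 (0:ℝ), 2 * |e| < ε' ∧ |e| < π ∧ cos (α + e) ≠ 0 ∧
      0 < sin (2 * α + e) * sin (2 * α) ∧
      |cos (α + e) - cos (-α)| + |-sin (α + e) - sin (-α)| + |(0:ℝ)| < ε ∧
      |(R e - cos α * cos (α + e)) / sin α + sin (-α)| + |cos α * sin (α + e) / sin α - cos (-α)|
        + |k e / sin α| < ε ∧
      |R e - cos 0| + |0 - sin 0| + |k e| < ε ∧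
      |(cos (α + e) - cos α * R e) / sin α + sin 0| + |sin (α + e) / sin α - cos 0|
        + |-(cos α * k e) / sin α| < ε := by
    refine (eventually_lt_of_continuousAt (by fun_prop) (by simp) hε').and
      ((eventually_lt_of_continuousAt (by fun_prop) (by simp) pi_pos).and
      ((ContinuousAt.eventually_ne (by fun_prop) (by simpa)).and
      ((continuousAt_const.eventually_lt (by fun_prop)
        (by rw [add_zero]; exact mul_self_pos.2 h2α)).and
      ((eventually_lt_of_continuousAt (by fun_prop) (by simp) hε).and
      ((eventually_lt_of_continuousAt (by fun_prop (disch := assumption)) ?_ hε).and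
      ((eventually_lt_of_continuousAt (by fun_prop) ?_ hε).and
      (eventually_lt_of_continuousAt (by fun_prop (disch := assumption)) ?_ hε)))))))
    · simp only [add_zero, hR0, hk0, sin_neg, cos_neg]
      rw [← hα2]
      simp [hα]
    · simp [hR0, hk0]
    · simp [hR0, hk0, hα]
  obtain ⟨e, e0, e1, e2, e3, e4, e5, e6, e7, e8⟩ : ∃ e : ℝ, sin e * sin (2 * α) < 0 ∧ _ := by
    rcases lt_or_gt_of_ne h2α with hlt | hgt
    · obtain ⟨e, he, hpos⟩ := ((Filter.Eventually.filter_mono nhdsWithin_le_nhds ev0).and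
        (eventually_mem_nhdsWithin (a := (0:ℝ)) (s := Set.Ioi 0))).exists
      refine ⟨e, mul_neg_of_pos_of_neg (sin_pos_of_pos_of_lt_pi hpos ?_) hlt, he⟩
      exact (le_abs_self e).trans_lt he.2.1
    · obtain ⟨e, he, hneg⟩ := ((Filter.Eventually.filter_mono nhdsWithin_le_nhds ev0).and
        (eventually_mem_nhdsWithin (a := (0:ℝ)) (s := Set.Iio 0))).exists
      refine ⟨e, mul_neg_of_neg_of_pos (sin_neg_of_neg_of_neg_pi_lt hneg ?_) hgt, he⟩
      have := (neg_le_abs e).trans_lt he.2.1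
      linarith
  have hRe : R e * cos (α + e) = cos α := by simp only [R]; field_simp
  have hdec : cos α ^ 2 ≤ cos (α + e) ^ 2 := by
    have : cos (α + e) ^ 2 - cos α ^ 2 = -(sin e * sin (2 * α + e)) := by
      rw [show 2 * α + e = α + (α + e) by ring, sin_add]
      have h1 : sin e = sin ((α + e) - α) := by ring_nf
      rw [h1, sin_sub]
      have a1 := sin_sq_add_cos_sq α
      have a2 := sin_sq_add_cos_sq (α + e)
      linear_combination (cos α ^ 2) * a2 - (cos (α + e) ^ 2) * a1
    have h3 : sin e * sin (2 * α + e) ≤ 0 := by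
      by_contra! hcon
      have := mul_neg_of_neg_of_pos e0 e4
      nlinarith [sq_nonneg (sin (2 * α)), mul_nonneg hcon.le (sq_nonneg (sin (2 * α)))]
    linarith
  have hR2 : 0 ≤ 1 - R e ^ 2 := by
    have : R e ^ 2 ≤ 1 := by
      simp only [R]
      rw [div_pow, div_le_one (by positivity)]
      exact hdec
    linarith
  have hk : k e * k e = 1 - R e ^ 2 := mul_self_sqrt hR2
  have hΔ := sin_sq_add_cos_sq (α + e)
  refine ⟨2 * e, ?_, by simpa [abs_mul] using e1, fun t => ?_⟩
  · rw [abs_pos]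
    intro h0
    have : e = 0 := by linarith
    rw [this] at e0
    simp at e0
  have s1 : ∀ t, P (frameComb u₀ v₀ w t (R e) 0 (k e)) = P (circ u₀ v₀ (t - (α + e))) := by
    intro t
    have := near t (-α) (cos (α + e)) (-sin (α + e)) 0 ((R e - cos α * cos (α + e)) / sin α)
      (cos α * sin (α + e) / sin α) (k e / sin α) (by nlinarith)
      (by field_simp; linear_combination hk - hα2 - 2 * cos α * hRe + cos α ^ 2 * hΔ)
      (by field_simp; linear_combination hRe - cos α * hΔ) e5 e6
    convert this using 2
    · congr 1 <;> field_simp <;> ring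
    · rw [sub_eq_add_neg, circ_add, frameComb, cos_neg, sin_neg]
      module
  have s2 : ∀ t, P (circ u₀ v₀ (t + (α + e))) = P (frameComb u₀ v₀ w t (R e) 0 (k e)) := by
    intro t
    have := near t 0 (R e) 0 (k e) ((cos (α + e) - cos α * R e) / sin α)
      (sin (α + e) / sin α) (-(cos α * k e) / sin α) (by nlinarith)
      (by field_simp; linear_combination hΔ - hα2 - 2 * cos α * hRe + cos α ^ 2 * hk)
      (by field_simp; linear_combination hRe - cos α * hk) e7 e8
    convert this using 2
    rw [circ_add, frameComb]
    have a1 : cos α * R e + sin α * ((cos (α + e) - cos α * R e) / sin α) = cos (α + e) := by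
      field_simp; ring
    have a2 : cos α * 0 + sin α * (sin (α + e) / sin α) = sin (α + e) := by
      field_simp; ring
    have a3 : cos α * k e + sin α * (-(cos α * k e) / sin α) = 0 := by
      field_simp; ring
    rw [a1, a2, a3, zero_smul, add_zero]
  have s3 : ∀ t, P (circ u₀ v₀ (t + 2 * (α + e))) = P (circ u₀ v₀ t) := by
    intro t
    have := (s2 (t + (α + e))).trans (s1 (t + (α + e)))
    rw [add_sub_cancel_right] at this
    rw [← this]; congr 2; ring
  have := s3 t
  rw [show t + 2 * (α + e) = t + 2 * e + α + α by ring, hper, hper] at this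
  exact this

/-- If, near a given great circle, an even function takes equal values at the endpoints of arcs of
length `α` with `sin α ≠ 0`, then it is constant on the circle. -/
lemma const_of_zigzag [FiniteDimensional ℝ E] (hE : 3 ≤ Module.finrank ℝ E) {P : E → ℝ}
    (hP : Continuous P) (heven : ∀ x, P (-x) = P x) {u₀ v₀ : E} (h : IsFrame u₀ v₀) {α ε : ℝ}
    (hα : sin α ≠ 0) (hε : 0 < ε)
    (H : ∀ s u v, IsFrame u v → ‖u - circ u₀ v₀ s‖ < ε → ‖v - circ u₀ v₀ (s + π / 2)‖ < ε →
      P (circ u v α) = P u) (s t : ℝ) : P (circ u₀ v₀ s) = P (circ u₀ v₀ t) := by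
  by_cases hc : cos α = 0
  · exact const_of_zigzag_of_cos_eq_zero hE hP heven h hc hε H s t
  · exact const_of_zigzag_of_cos_ne_zero hE hP h hα hc hε H s t

end Zigzag

section Rotations

open Real Filter Topology

variable {E : Type*} [NormedAddCommGroup E] [InnerProductSpace ℝ E]

/-- The set of orthonormal pairs. -/
def frames (E : Type*) [NormedAddCommGroup E] [InnerProductSpace ℝ E] : Set (E × E) :=
  {x | IsFrame x.1 x.2}

lemma isClosed_frames : IsClosed (frames E) := by
  have : frames E = {x | ‖x.1‖ = 1} ∩ ({x | ‖x.2‖ = 1} ∩ {x | ⟪x.1, x.2⟫ = 0}) := rfl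
  rw [this]
  refine IsClosed.inter ?_ (IsClosed.inter ?_ ?_) <;>
    exact isClosed_eq (by fun_prop) (by fun_prop)

lemma integral_circ_add {f : E → ℝ} (u v : E) (α : ℝ) :
    ∫ t in (0:ℝ)..(2 * π), f (circ u v (t + α)) = ∫ t in (0:ℝ)..(2 * π), f (circ u v t) := by
  rw [intervalIntegral.integral_comp_add_right (fun t => f (circ u v t)) α, zero_add, add_comm]
  have hper : Function.Periodic (fun t => f (circ u v t)) (2 * π) := by
    intro t; simp only [circ_periodic u v t]
  simpa using hper.intervalIntegral_add_eq α 0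

variable [FiniteDimensional ℝ E]

/-- Functions whose restrictions to every great circle agree up to a rotation have the same
even part. -/
lemma even_part_eq (hE : 3 ≤ Module.finrank ℝ E) {f g : E → ℝ} (hf : Continuous f)
    (hg : Continuous g)
    (H : ∀ u v, IsFrame u v → ∃ α, ∀ t, g (circ u v (t + α)) = f (circ u v t))
    {x : E} (hx : ‖x‖ = 1) : f x + f (-x) = g x + g (-x) := by
  have key := eq_zero_of_funk hE (h := fun x => (f x + f (-x)) - (g x + g (-x))) (by fun_prop)
    (by intro x; simp only [neg_neg]; ring) ?_ hx
  · linarith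
  · intro u v huv
    obtain ⟨α, hα⟩ := H u v huv
    have ci : ∀ {k : ℝ → ℝ}, Continuous k →
        IntervalIntegrable k MeasureTheory.volume 0 (2 * π) := fun h => h.intervalIntegrable _ _
    rw [intervalIntegral.integral_sub (ci (by fun_prop)) (ci (by fun_prop)),
      intervalIntegral.integral_add (ci (by fun_prop)) (ci (by fun_prop)),
      intervalIntegral.integral_add (ci (by fun_prop)) (ci (by fun_prop))]
    have e1 : ∀ k : E → ℝ, ∫ t in (0:ℝ)..(2 * π), k (-circ u v t)
        = ∫ t in (0:ℝ)..(2 * π), k (circ u v t) := by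
      intro k
      simp only [← circ_add_pi]
      exact integral_circ_add u v π
    rw [e1, e1]
    simp only [← hα]
    rw [integral_circ_add]
    ring

/-- Pointwise dichotomy for families whose restrictions to great circles agree up to
rotations. -/
lemma pointwise_dichotomy {ι : Type*} (hE : 3 ≤ Module.finrank ℝ E) {F G : ι → E → ℝ}
    (hF : ∀ a, Continuous (F a)) (hG : ∀ a, Continuous (G a))
    (H : ∀ u v, IsFrame u v → ∃ α, ∀ a t, G a (circ u v (t + α)) = F a (circ u v t))
    {x : E} (hx : ‖x‖ = 1) : (∀ a, G a x = F a x) ∨ (∀ a, G a x = F a (-x)) := by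
  have h1 : ∀ a, F a x + F a (-x) = G a x + G a (-x) := fun a =>
    even_part_eq hE (hF a) (hG a) (fun u v h => (H u v h).imp fun α h => h a) hx
  have h2 : ∀ a b, F a x * F b x + F a (-x) * F b (-x) = G a x * G b x + G a (-x) * G b (-x) :=
    fun a b => even_part_eq hE (f := fun x => F a x * F b x) (g := fun x => G a x * G b x)
      ((hF a).mul (hF b)) ((hG a).mul (hG b))
      (fun u v h => (H u v h).imp fun α h t => by rw [h a, h b]) hx
  have h3 : ∀ a, G a x = F a x ∨ G a x = F a (-x) := by
    intro a
    have e1 := h1 a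
    have e2 := h2 a a
    have : (G a x - F a x) * (G a x - F a (-x)) = 0 := by
      have e3 : G a (-x) = F a x + F a (-x) - G a x := by linarith
      rw [e3] at e2
      nlinarith
    rcases mul_eq_zero.1 this with h | h
    · left; linarith
    · right; linarith
  by_contra! hcon
  obtain ⟨⟨a, ha⟩, b, hb⟩ := hcon
  have ga := (h3 a).resolve_left ha
  have gb := (h3 b).resolve_right hb
  have ga' : G a (-x) = F a x := by linarith [h1 a]
  have gb' : G b (-x) = F b (-x) := by linarith [h1 b]
  have e := h2 a b
  rw [ga, gb, ga', gb'] at e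
  have : (F a x - F a (-x)) * (F b x - F b (-x)) = 0 := by nlinarith
  rcases mul_eq_zero.1 this with h | h
  · exact ha (by linarith)
  · exact hb (by linarith)

/-- Two families of continuous functions on the sphere without common symmetries of order two on
great circles, whose restrictions to great circles agree up to rotations, coincide up to the
antipodal map. -/
lemma eq_or_eq_neg_of_rotations {ι : Type*} (hE : 3 ≤ Module.finrank ℝ E) {F G : ι → E → ℝ}
    (hF : ∀ a, Continuous (F a)) (hG : ∀ a, Continuous (G a))
    (H : ∀ u v, IsFrame u v → ∃ α, ∀ a t, G a (circ u v (t + α)) = F a (circ u v t))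
    (nosym : ∀ u v, IsFrame u v → ∃ a t, F a (circ u v (t + π)) ≠ F a (circ u v t)) :
    (∀ a x, ‖x‖ = 1 → G a x = F a x) ∨ (∀ a x, ‖x‖ = 1 → G a x = F a (-x)) := by
  set P : ι → E → ℝ := fun a x => (F a x - F a (-x)) ^ 2 with hPdef
  have hPc : ∀ a, Continuous (P a) := fun a => by
    have := hF a
    fun_prop
  have hPe : ∀ a x, P a (-x) = P a x := by intro a x; simp only [hPdef, neg_neg]; ring
  have dich := fun {x : E} => pointwise_dichotomy (x := x) hE hF hG H
  have hPG : ∀ a x, ‖x‖ = 1 → P a x = (G a x - G a (-x)) ^ 2 := by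
    intro a x hx
    have h1 := even_part_eq hE (hF a) (hG a) (fun u v h => (H u v h).imp fun α h => h a) hx
    rcases dich hx with h | h
    · have := h a
      rw [show G a (-x) = F a (-x) by linarith, this]
    · have := h a
      rw [show G a (-x) = F a x by linarith, this]
      simp only [hPdef]; ring
  have hPα : ∀ u v, IsFrame u v → ∀ α, (∀ a t, G a (circ u v (t + α)) = F a (circ u v t)) →
      ∀ a t, P a (circ u v (t + α)) = P a (circ u v t) := by
    intro u v huv α hα a t
    rw [hPG a _ (huv.norm_circ _), ← circ_add_pi, add_right_comm, hα, hα, circ_add_pi]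
  have notconst : ∀ u v, IsFrame u v →
      ¬ ∀ a s t, P a (circ u v s) = P a (circ u v t) := by
    intro u v huv hconst
    obtain ⟨a, t, hat⟩ := nosym u v huv
    have hFa := hF a
    have := eq_zero_of_antiperiodic (o := fun t => F a (circ u v t) - F a (-circ u v t))
      (by fun_prop) (by intro t; rw [circ_add_pi, neg_neg]; ring) (fun s t => hconst a s t) t
    apply hat
    rw [circ_add_pi]
    linarith
  by_contra! hcon
  obtain ⟨⟨a₁, x₁, hx₁, hne₁⟩, a₂, x₂, hx₂, hne₂⟩ := hcon
  obtain ⟨v₁, t₂, hfr, ht₂⟩ := exists_frame_through hE hx₁ hx₂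
  have rational : ∀ x : frames E, ∃ q : ℚ, ∀ a t,
      G a (circ x.1.1 x.1.2 (t + q * (2 * π))) = F a (circ x.1.1 x.1.2 t) := by
    rintro ⟨⟨u, v⟩, huv⟩
    obtain ⟨α, hα⟩ := H u v huv
    by_cases hirr : Irrational (α / (2 * π))
    · exfalso
      refine notconst u v huv fun a s t => ?_
      have hPa := hPc a
      refine const_of_dense_periods (p := fun t => P a (circ u v t)) (by fun_prop) ?_ s t
      refine (dense_addSubgroupClosure_pair_iff.2 hirr).mono ?_
      refine (AddSubgroup.closure_le _).2 ?_
      rintro c (rfl | rfl)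
      · exact fun t => hPα u v huv _ hα a t
      · intro t
        simp only [circ_periodic u v t]
    · rw [Irrational, not_not] at hirr
      obtain ⟨q, hq⟩ := hirr
      refine ⟨q, ?_⟩
      rw [hq, div_mul_cancel₀ _ (by positivity)]
      exact hα
  set Ξ : ℚ → Set (frames E) := fun q => {x | ∀ a t,
      G a (circ x.1.1 x.1.2 (t + q * (2 * π))) = F a (circ x.1.1 x.1.2 t)} with hΞ
  have hΞc : ∀ q, IsClosed (Ξ q) := by
    intro q
    have : Ξ q = ⋂ a, ⋂ t, {x : frames E |
        G a (circ x.1.1 x.1.2 (t + q * (2 * π))) = F a (circ x.1.1 x.1.2 t)} := by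
      ext x; simp [hΞ]
    rw [this]
    refine isClosed_iInter fun a => isClosed_iInter fun t => ?_
    have h1 := hF a
    have h2 := hG a
    exact isClosed_eq (by fun_prop) (by fun_prop)
  have hΞu : ⋃ q, Ξ q = Set.univ := by
    rw [Set.eq_univ_iff_forall]
    exact fun x => Set.mem_iUnion.2 (rational x)
  have : CompleteSpace (frames E) := isClosed_frames.completeSpace_coe
  have hdense := dense_iUnion_interior_of_closed hΞc hΞu
  set O : Set (frames E) := {x | G a₁ x.1.1 ≠ F a₁ x.1.1} ∩
    {x | G a₂ (circ x.1.1 x.1.2 t₂) ≠ F a₂ (-circ x.1.1 x.1.2 t₂)} with hO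
  have hOo : IsOpen O := by
    have h1 := hF a₁
    have h2 := hG a₁
    have h3 := hF a₂
    have h4 := hG a₂
    exact (isOpen_ne_fun (by fun_prop) (by fun_prop)).inter
      (isOpen_ne_fun (by fun_prop) (by fun_prop))
  obtain ⟨x₀, hxO, hxΞ⟩ := hdense.inter_open_nonempty O hOo
    ⟨⟨(x₁, v₁), hfr⟩, hne₁, by simpa [ht₂] using hne₂⟩
  obtain ⟨q, hq⟩ := Set.mem_iUnion.1 hxΞ
  set α : ℝ := q * (2 * π) with hα
  have hx₀ : IsFrame x₀.1.1 x₀.1.2 := x₀.2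
  have hsin : sin α ≠ 0 := by
    intro h0
    have hin : ∀ a t, G a (circ x₀.1.1 x₀.1.2 (t + α)) = F a (circ x₀.1.1 x₀.1.2 t) :=
      interior_subset hq
    rcases sin_eq_zero_iff_cos_eq.1 h0 with hc | hc
    · have := hin a₁ 0
      rw [circ_add, h0, hc, circ_zero, zero_smul, one_smul, add_zero] at this
      exact hxO.1 this
    · have := hin a₂ (t₂ + π)
      rw [circ_add, h0, hc, circ_add_pi, zero_smul, add_zero, neg_one_smul, neg_neg] at this
      exact hxO.2 this
  obtain ⟨ε, hε, hball⟩ := Metric.mem_nhds_iff.1 (mem_interior_iff_mem_nhds.1 hq)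
  refine notconst _ _ hx₀ fun a s t =>
    const_of_zigzag hE (hPc a) (hPe a) hx₀ hsin (half_pos hε) (fun s u v huv h1 h2 => ?_) s t
  have hmem : (⟨(circ u v (-s), circ u v (-s + π / 2)), huv.rotate (-s)⟩ : frames E) ∈ Ξ q := by
    apply hball
    have b : ∀ r, ‖circ u v (-s + r) - circ x₀.1.1 x₀.1.2 r‖ < ε := by
      intro r
      have : circ u v (-s + r) - circ x₀.1.1 x₀.1.2 r
          = cos (-s + r) • (u - circ x₀.1.1 x₀.1.2 s)
            + sin (-s + r) • (v - circ x₀.1.1 x₀.1.2 (s + π / 2)) := by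
        have e := circ_add x₀.1.1 x₀.1.2 s (-s + r)
        rw [add_neg_cancel_left] at e
        rw [e, circ]; module
      rw [this]
      refine (norm_add_le _ _).trans_lt ?_
      rw [norm_smul, norm_smul, norm_eq_abs, norm_eq_abs]
      have k1 := mul_le_mul_of_nonneg_right (abs_cos_le_one (-s + r))
        (norm_nonneg (u - circ x₀.1.1 x₀.1.2 s))
      have k2 := mul_le_mul_of_nonneg_right (abs_sin_le_one (-s + r))
        (norm_nonneg (v - circ x₀.1.1 x₀.1.2 (s + π / 2)))
      linarith
    rw [Metric.mem_ball, Subtype.dist_eq, Prod.dist_eq, max_lt_iff, dist_eq_norm, dist_eq_norm]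
    constructor
    · simpa [circ_zero] using b 0
    · simpa [circ_pi_div_two] using b (π / 2)
  have := hPα u v huv α (fun a t => ?_) a 0
  · simpa [circ_zero] using this
  · have := hmem a (s + t)
    simp only [circ_circ] at this
    rw [show -s + (s + t + q * (2 * π)) = t + α by rw [hα]; ring,
      show -s + (s + t) = t by ring] at this
    exact this

end Rotations

section Reflections

open Filter Topology ComplexConjugate Real

/-- The unnormalised Fourier coefficients of a `2π`-periodic function. -/
def fourierInt (f : ℝ → ℝ) (k : ℤ) : ℂ :=
  ∫ t in (0:ℝ)..(2 * π), (f t : ℂ) * Complex.exp (k * t * Complex.I)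

lemma exp_int_periodic (k : ℤ) :
    Function.Periodic (fun t : ℝ => Complex.exp (k * t * Complex.I)) (2 * π) := by
  intro t
  simp only
  rw [Complex.exp_eq_exp_iff_exists_int]
  exact ⟨k, by push_cast; ring⟩

lemma fourierInt_shift {f : ℝ → ℝ} (hp : Function.Periodic f (2 * π)) (s : ℝ) (k : ℤ) :
    fourierInt (fun t => f (s + t)) k = Complex.exp (-(k * s * Complex.I)) * fourierInt f k := by
  have hper : Function.Periodic
      (fun t : ℝ => (f t : ℂ) * Complex.exp (k * t * Complex.I)) (2 * π) := by
    intro t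
    have := exp_int_periodic k t
    simp only at this
    simp only [hp t, this]
  have h1 := hper.intervalIntegral_add_eq s 0
  rw [zero_add] at h1
  rw [fourierInt, fourierInt, ← h1, ← intervalIntegral.integral_const_mul]
  have h2 := intervalIntegral.integral_comp_add_left (a := 0) (b := 2 * π)
    (fun t : ℝ => Complex.exp (-(k * s * Complex.I)) *
      ((f t : ℂ) * Complex.exp (k * t * Complex.I)))
    s
  rw [add_zero] at h2
  rw [← h2]
  refine intervalIntegral.integral_congr fun t _ => ?_
  rw [mul_left_comm, ← Complex.exp_add]
  congr 2
  push_cast; ring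

lemma fourierInt_conj (f : ℝ → ℝ) (k : ℤ) : fourierInt f (-k) = conj (fourierInt f k) := by
  rw [fourierInt, fourierInt, ← intervalIntegral.intervalIntegral_conj]
  refine intervalIntegral.integral_congr fun t _ => ?_
  simp [← Complex.exp_conj]

lemma fourierInt_reflect {f : ℝ → ℝ} (hp : Function.Periodic f (2 * π)) (k : ℤ) :
    fourierInt (fun t => f (-t)) k = conj (fourierInt f k) := by
  rw [← fourierInt_conj]
  have hper : Function.Periodic
      (fun t : ℝ => (f t : ℂ) * Complex.exp ((-k : ℤ) * t * Complex.I)) (2 * π) := by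
    intro t
    have := exp_int_periodic (-k) t
    simp only at this
    simp only [hp t, this]
  have h1 := hper.intervalIntegral_add_eq (-(2 * π)) 0
  rw [zero_add, neg_add_cancel] at h1
  rw [fourierInt, fourierInt, ← h1]
  have h2 := intervalIntegral.integral_comp_neg (a := 0) (b := 2 * π)
    (fun t : ℝ => (f t : ℂ) * Complex.exp ((-k : ℤ) * t * Complex.I))
  rw [neg_zero] at h2
  rw [← h2]
  refine intervalIntegral.integral_congr fun t _ => ?_
  simp

lemma fourierInt_sub_const {f : ℝ → ℝ} (hf : Continuous f) (c : ℝ) (k : ℤ) :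
    fourierInt (fun t => f t - c) k
      = fourierInt f k - c * ∫ t in (0:ℝ)..(2 * π), Complex.exp (k * t * Complex.I) := by
  rw [fourierInt, fourierInt, ← intervalIntegral.integral_const_mul,
    ← intervalIntegral.integral_sub (Continuous.intervalIntegrable (by fun_prop) _ _)
      (Continuous.intervalIntegrable (by fun_prop) _ _)]
  refine intervalIntegral.integral_congr fun t _ => ?_
  push_cast; ring

lemma integral_exp_int {k : ℤ} (hk : k ≠ 0) :
    ∫ t in (0:ℝ)..(2 * π), Complex.exp (k * t * Complex.I) = 0 := by
  have hc : (k * Complex.I : ℂ) ≠ 0 := mul_ne_zero (by exact_mod_cast hk) Complex.I_ne_zero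
  have := integral_exp_mul_complex (a := 0) (b := 2 * π) hc
  have e : ∀ t : ℝ, (k * t * Complex.I : ℂ) = k * Complex.I * t := fun t => by ring
  simp only [e]
  rw [this]
  have h2 := exp_int_periodic k 0
  simp only [zero_add, Complex.ofReal_zero, mul_zero, zero_mul] at h2
  rw [e] at h2
  rw [h2]
  simp

lemma eq_zero_of_fourierInt {f : ℝ → ℝ} (hf : Continuous f) (hp : Function.Periodic f (2 * π))
    (h : ∀ k, fourierInt f k = 0) (t : ℝ) : f t = 0 := by
  have : Fact (0 < 2 * π) := ⟨by positivity⟩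
  have hp' : Function.Periodic (fun t => (f t : ℂ)) (2 * π) := fun t => by simp only [hp t]
  have hc : Continuous (hp'.lift : AddCircle (2 * π) → ℂ) := by
    refine continuous_coinduced_dom.2 ?_
    change Continuous fun t => (f t : ℂ)
    fun_prop
  set g : C(AddCircle (2 * π), ℂ) := ⟨hp'.lift, hc⟩ with hg
  have hcoef : ∀ n, fourierCoeff g n = 0 := by
    intro n
    rw [fourierCoeff_eq_intervalIntegral _ n 0, zero_add]
    have := h (-n)
    rw [fourierInt] at this
    suffices e : ∫ x in (0:ℝ)..(2 * π), fourier (-n) (x : AddCircle (2 * π)) • g x = 0 by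
      rw [e, smul_zero]
    rw [← this]
    refine intervalIntegral.integral_congr fun t _ => ?_
    rw [fourier_coe_apply, smul_eq_mul, mul_comm]
    have e1 : g (t : AddCircle (2 * π)) = (f t : ℂ) := rfl
    rw [e1]
    congr 2
    have : (π : ℂ) ≠ 0 := by exact_mod_cast Real.pi_ne_zero
    push_cast
    field_simp
  have hs := has_pointwise_sum_fourier_series_of_summable (f := g)
    (by rw [show fourierCoeff g = fun _ => 0 from funext hcoef]; exact summable_zero)
    (t : AddCircle (2 * π))
  simp only [hcoef, zero_smul] at hs
  have e1 : g (t : AddCircle (2 * π)) = (f t : ℂ) := rfl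
  have := hs.unique hasSum_zero
  rw [e1] at this
  exact_mod_cast this

/-- A nonconstant periodic function has a nonzero Fourier coefficient of positive index. -/
lemma exists_fourierInt_ne_zero {f : ℝ → ℝ} (hf : Continuous f) (hp : Function.Periodic f (2 * π))
    {s t : ℝ} (hst : f s ≠ f t) : ∃ k : ℕ, 0 < k ∧ fourierInt f k ≠ 0 := by
  by_contra! hcon
  have hzero : ∀ k : ℤ, k ≠ 0 → fourierInt f k = 0 := by
    intro k hk
    obtain ⟨n, rfl | rfl⟩ := k.eq_nat_or_neg
    · exact hcon n (by omega)
    · rw [fourierInt_conj, hcon n (by omega), map_zero]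
  set c : ℝ := (2 * π)⁻¹ * ∫ t in (0:ℝ)..(2 * π), f t with hc
  have h0 : ∀ k, fourierInt (fun t => f t - c) k = 0 := by
    intro k
    rw [fourierInt_sub_const hf]
    by_cases hk : k = 0
    · subst hk
      have : fourierInt f 0 = ((2 * π * c : ℝ) : ℂ) := by
        rw [hc, mul_inv_cancel_left₀ (by positivity), ← intervalIntegral.integral_ofReal]
        simp [fourierInt]
      rw [this]
      simp
      ring
    · rw [hzero k hk, integral_exp_int hk]; simp
  have := eq_zero_of_fourierInt (f := fun t => f t - c) (by fun_prop)
    (fun t => by simp only [hp t]) h0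
  have h1 := this s
  have h2 := this t
  exact hst (by linarith)

lemma exists_continuous_log {g : ℝ × ℝ → ℂ} (hg : Continuous g) (h0 : ∀ x, g x ≠ 0) :
    ∃ β : ℝ × ℝ → ℂ, Continuous β ∧ ∀ x, Complex.exp (β x) = g x := by
  have hs : IsSimplyConnected (Set.univ : Set (ℝ × ℝ)) := by
    have := (convex_univ (𝕜 := ℝ) (E := ℝ × ℝ)).contractibleSpace Set.univ_nonempty
    exact SimplyConnectedSpace.ofContractible _
  obtain ⟨β, h1, h2⟩ := Complex.exists_continuousOn_eqOn_exp_comp hs isOpen_univ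
    hg.continuousOn (by rintro ⟨x, -, hx⟩; exact h0 x hx)
  exact ⟨β, continuousOn_univ.1 h1, fun x => h2 (Set.mem_univ x)⟩

lemma const_of_exp_eq_one {X : Type*} [TopologicalSpace X] [PreconnectedSpace X] {f : X → ℂ}
    (hf : Continuous f) (h : ∀ x, Complex.exp (f x) = 1) (x y : X) : f x = f y := by
  have hn : ∀ x, ∃ n : ℤ, f x = n * (2 * π * Complex.I) := fun x => Complex.exp_eq_one_iff.1 (h x)
  choose n hn using hn
  have him : ∀ x, (f x).im = n x * (2 * π) := by
    intro x; rw [hn x]; simp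
  have key : ∀ x y, ¬ n x < n y := by
    intro x y hxy
    have hpi := Real.pi_pos
    have h1 : (n x : ℝ) + 1 ≤ n y := by exact_mod_cast hxy
    obtain ⟨z, hz⟩ := intermediate_value_univ x y (Complex.continuous_im.comp hf)
      (show (n x + 1 / 2) * (2 * π) ∈ Set.Icc _ _ by
        simp only [Function.comp, him]
        constructor <;> nlinarith)
    simp only [Function.comp, him] at hz
    have h2 : (n z : ℝ) = n x + 1 / 2 := mul_right_cancel₀ (by positivity) hz
    have h3 : (2 * n z : ℝ) = 2 * n x + 1 := by linarith
    have h4 : 2 * n z = 2 * n x + 1 := by exact_mod_cast h3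
    omega
  have : n x = n y := le_antisymm (not_lt.1 (key y x)) (not_lt.1 (key x y))
  rw [hn x, hn y, this]

variable {E : Type*} [NormedAddCommGroup E] [InnerProductSpace ℝ E]

/-- There is no nonvanishing function on orthonormal pairs which has nonzero degree on
rotations and is conjugated by the reflection of the second vector. -/
lemma false_of_degree [FiniteDimensional ℝ E] (hE : 3 ≤ Module.finrank ℝ E) {T : E → E → ℂ}
    (hT : Continuous (Function.uncurry T)) (hT0 : ∀ u v, IsFrame u v → T u v ≠ 0) {N : ℤ}
    (hN : N ≠ 0)
    (hrot : ∀ u v s, T (circ u v s) (circ u v (s + π / 2))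
      = Complex.exp (-(2 * N * s * Complex.I)) * T u v)
    (hconj : ∀ u v, T u (-v) = conj (T u v)) : False := by
  obtain ⟨e₃, e₁, he, -⟩ := exists_frame_orth hE (0 : E)
  obtain ⟨e₂, hn₂, h₂₃, h₂₁⟩ := exists_unit_orth hE e₃ e₁
  set n : ℝ → E := fun σ => circ e₃ e₁ σ with hn
  set m : ℝ → E := fun σ => circ e₃ e₁ (σ + π / 2) with hm
  set p : ℝ → ℝ → E := fun σ s => circ (m σ) e₂ s with hp
  set v : ℝ → ℝ → E := fun σ s => circ (m σ) e₂ (s + π / 2) with hv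
  set u : ℝ → ℝ → E := fun σ s => circ (p σ s) (n σ) σ with hu
  have hfr : ∀ σ s, IsFrame (u σ s) (v σ s) := by
    intro σ s
    have f1 : IsFrame (n σ) (m σ) := he.rotate σ
    have a1 : ⟪e₂, n σ⟫ = 0 := IsFrame.mul_circ h₂₃ h₂₁ _
    have a2 : ⟪e₂, m σ⟫ = 0 := IsFrame.mul_circ h₂₃ h₂₁ _
    have f2 : IsFrame (m σ) e₂ := ⟨f1.2.1, hn₂, by rwa [real_inner_comm]⟩
    have f3 : IsFrame (p σ s) (v σ s) := f2.rotate s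
    have a3 : ∀ r, ⟪n σ, circ (m σ) e₂ r⟫ = 0 :=
      IsFrame.mul_circ f1.2.2 (by rwa [real_inner_comm])
    have f4 : IsFrame (p σ s) (n σ) := ⟨f3.1, f1.1, by rw [real_inner_comm]; exact a3 _⟩
    refine ⟨f4.norm_circ _, f3.2.1, ?_⟩
    rw [real_inner_comm]
    exact IsFrame.mul_circ f3.inner_right_left (by rw [real_inner_comm]; exact a3 _) _
  have hcont : Continuous fun x : ℝ × ℝ => T (u x.1 x.2) (v x.1 x.2) := by
    have : Continuous fun x : ℝ × ℝ => (u x.1 x.2, v x.1 x.2) := by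
      simp only [hu, hv, hp, hn, hm]
      fun_prop
    exact hT.comp this
  obtain ⟨β, hβ, hexp⟩ := exists_continuous_log hcont fun x => hT0 _ _ (hfr x.1 x.2)
  have hper : ∀ σ s, T (u σ (s + 2 * π)) (v σ (s + 2 * π)) = T (u σ s) (v σ s) := by
    intro σ s
    have e1 : p σ (s + 2 * π) = p σ s := circ_periodic _ _ _
    have e2 : v σ (s + 2 * π) = v σ s := by
      simp only [hv]; rw [add_right_comm]; exact circ_periodic _ _ _
    simp only [hu, e1, e2]
  have hD : ∀ x y : ℝ × ℝ, β (x.1, x.2 + 2 * π) - β x = β (y.1, y.2 + 2 * π) - β y := by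
    refine const_of_exp_eq_one (f := fun x : ℝ × ℝ => β (x.1, x.2 + 2 * π) - β x)
      (by fun_prop) fun x => ?_
    rw [Complex.exp_sub, hexp, hexp, hper, div_self (hT0 _ _ (hfr _ _))]
  have hflat : ∀ s, β (0, s) + 2 * N * s * Complex.I = β (0, 0) := by
    intro s
    have hu0 : ∀ s, u 0 s = circ e₁ e₂ s := by
      intro s
      simp only [hu, circ_zero, hp, hm, zero_add, circ_pi_div_two]
    have hv0 : ∀ s, v 0 s = circ e₁ e₂ (s + π / 2) := by
      intro s
      simp only [hv, hm, zero_add, circ_pi_div_two]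
    have := const_of_exp_eq_one (f := fun s : ℝ => β (0, s) + 2 * N * s * Complex.I - β (0, 0))
      (by fun_prop) (fun s => ?_) s 0
    · simp only [Complex.ofReal_zero, mul_zero, zero_mul, add_zero, sub_self] at this
      exact sub_eq_zero.1 this
    · rw [Complex.exp_sub, Complex.exp_add, hexp, hexp]
      simp only [hu0, hv0]
      rw [hrot, hrot, mul_right_comm, ← Complex.exp_add]
      have := hT0 _ _ (hfr 0 0)
      rw [hu0, hv0, hrot] at this
      simp only [neg_add_cancel, Complex.exp_zero, one_mul, Complex.ofReal_zero, mul_zero, zero_mul,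
        neg_zero] at this ⊢
      exact div_self this
  have hhalf : ∀ s, β (π / 2, s + π) - conj (β (π / 2, s)) =
      β (π / 2, 0 + π) - conj (β (π / 2, 0)) ∧
      Complex.exp (β (π / 2, s + π) - conj (β (π / 2, s))) = 1 := by
    have hm1 : m (π / 2) = -e₃ := by
      simp only [hm, add_halves]
      rw [← zero_add π, circ_add_pi, circ_zero]
    have hu1 : ∀ s, u (π / 2) s = e₁ := by
      intro s
      simp only [hu, circ_pi_div_two, hn]
    have hv1 : ∀ s, v (π / 2) (s + π) = -v (π / 2) s := by
      intro s
      simp only [hv]; rw [add_right_comm]; exact circ_add_pi _ _ _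
    have hone : ∀ s, Complex.exp (β (π / 2, s + π) - conj (β (π / 2, s))) = 1 := by
      intro s
      rw [Complex.exp_sub, Complex.exp_conj, hexp, hexp]
      simp only [hv1, hu1, hconj]
      refine div_self ?_
      rw [← hconj]
      have := hT0 _ _ (hfr (π / 2) s).neg_right
      rwa [hu1] at this
    intro s
    have hc : Continuous fun s => β (π / 2, s + π) - conj (β (π / 2, s)) :=
      (by fun_prop : Continuous fun s => β (π / 2, s + π)).sub
        (Complex.continuous_conj.comp (by fun_prop))
    exact ⟨const_of_exp_eq_one hc hone s 0, hone s⟩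
  obtain ⟨c1, c2⟩ := hhalf 0
  obtain ⟨c3, -⟩ := hhalf π
  set C := β (π / 2, 0 + π) - conj (β (π / 2, 0)) with hC
  have hre : C.re = 0 := by
    obtain ⟨k, hk⟩ := Complex.exp_eq_one_iff.1 c2
    rw [hk]; simp
  have hzero : β (π / 2, 0 + 2 * π) - β (π / 2, 0) = 0 := by
    have h1 : β (π / 2, 0 + π) = C + conj (β (π / 2, 0)) := by rw [hC]; ring
    have h2 : β (π / 2, 0 + 2 * π) = C + conj (β (π / 2, 0 + π)) := by
      rw [← c3, two_mul, ← add_assoc, zero_add]; ring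
    rw [h2, h1, map_add, Complex.conj_conj]
    apply Complex.ext
    · simp [hre]
    · simp
  have h1 := hD (π / 2, 0) (0, 0)
  simp only at h1
  rw [hzero] at h1
  have h2 := hflat (0 + 2 * π)
  have h3 : (2 * N * ((0 + 2 * π : ℝ) : ℂ) * Complex.I) = 0 := by
    linear_combination h2 + h1
  have hpi : (π : ℂ) ≠ 0 := by exact_mod_cast Real.pi_ne_zero
  have hN' : (N : ℂ) ≠ 0 := by exact_mod_cast hN
  simp [hpi, hN'] at h3

/-- There are no two families of continuous functions on the sphere without common symmetries of
order two on great circles, whose restrictions to great circles agree up to reflections. -/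
lemma false_of_reflections [FiniteDimensional ℝ E] {ι : Type*} (hE : 3 ≤ Module.finrank ℝ E)
    {F G : ι → E → ℝ} (hF : ∀ a, Continuous (F a)) (hG : ∀ a, Continuous (G a))
    (H : ∀ u v, IsFrame u v → ∃ α, ∀ a t, G a (circ u v (α - t)) = F a (circ u v t))
    (nosym : ∀ u v, IsFrame u v → ∃ a t, F a (circ u v (t + π)) ≠ F a (circ u v t)) : False := by
  set c : (E → ℝ) → ℕ → E → E → ℂ := fun f k u v => fourierInt (fun t => f (circ u v t)) k with hc
  have hcc : ∀ f : E → ℝ, Continuous f → ∀ k, Continuous (Function.uncurry (c f k)) := by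
    intro f hf k
    simp only [hc, fourierInt]
    refine intervalIntegral.continuous_parametric_intervalIntegral_of_continuous' ?_ _ _
    simp only [Function.uncurry_def]
    fun_prop
  have hper : ∀ (f : E → ℝ) u v, Function.Periodic (fun t => f (circ u v t)) (2 * π) := by
    intro f u v t; simp only [circ_periodic u v t]
  have hrot : ∀ (f : E → ℝ) k u v s, c f k (circ u v s) (circ u v (s + π / 2))
      = Complex.exp (-(k * s * Complex.I)) * c f k u v := by
    intro f k u v s
    simp only [hc, circ_circ]
    rw [fourierInt_shift (hper f u v)]
    simp
  have hconj : ∀ (f : E → ℝ) k u v, c f k u (-v) = conj (c f k u v) := by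
    intro f k u v
    simp only [hc, circ_neg_right]
    exact fourierInt_reflect (hper f u v) k
  have hFG : ∀ u v, IsFrame u v → ∃ α : ℝ, ∀ a k,
      c (G a) k u v = Complex.exp (k * α * Complex.I) * conj (c (F a) k u v) := by
    intro u v huv
    obtain ⟨α, hα⟩ := H u v huv
    refine ⟨α, fun a k => ?_⟩
    have e : ∀ t, G a (circ u v t) = F a (circ u (-v) (-α + t)) := by
      intro t
      have := hα a (α - t)
      rw [sub_sub_cancel] at this
      rw [this, circ_neg_right]
      congr 2; ring
    rw [← hconj]
    simp only [hc, e]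
    rw [fourierInt_shift (hper (F a) u (-v))]
    simp
  have hne : ∀ u v, IsFrame u v → ∃ x : ℕ × ι, 0 < x.1 ∧ c (F x.2) x.1 u v ≠ 0 := by
    intro u v huv
    obtain ⟨a, t, hat⟩ := nosym u v huv
    have := hF a
    obtain ⟨k, h1, h2⟩ := exists_fourierInt_ne_zero (f := fun t => F a (circ u v t)) (by fun_prop)
      (hper _ u v) hat
    exact ⟨(k, a), h1, h2⟩
  have hcompact : IsCompact (frames E) := by
    refine Metric.isCompact_of_isClosed_isBounded isClosed_frames ?_
    refine Metric.isBounded_closedBall (x := (0 : E × E)) (r := 1) |>.subset fun x hx => ?_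
    rw [mem_closedBall_zero_iff, Prod.norm_def]
    exact max_le hx.1.le hx.2.1.le
  obtain ⟨S, hS⟩ := hcompact.elim_finite_subcover
    (fun x : {x : ℕ × ι // 0 < x.1} => {y : E × E | c (F x.1.2) x.1.1 y.1 y.2 ≠ 0})
    (fun x => isOpen_ne_fun (hcc _ (hF _) _) continuous_const)
    (fun y hy => by
      obtain ⟨x, h1, h2⟩ := hne y.1 y.2 hy
      exact Set.mem_iUnion.2 ⟨⟨x, h1⟩, h2⟩)
  set N : ℕ := ∏ x ∈ S, x.1.1 with hNdef
  have hN0 : 0 < N := Finset.prod_pos fun x _ => x.2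
  have hdvd : ∀ x ∈ S, x.1.1 * (N / x.1.1) = N := fun x hx =>
    Nat.mul_div_cancel' (Finset.dvd_prod_of_mem (fun x : {x : ℕ × ι // 0 < x.1} => x.1.1) hx)
  have hdvd' : ∀ x ∈ S, ((x.1.1 : ℕ) : ℂ) * ((N / x.1.1 : ℕ) : ℂ) = N := fun x hx => by
    rw [← Nat.cast_mul, hdvd x hx]
  refine false_of_degree hE (T := fun u v => ∑ x ∈ S,
    (c (F x.1.2) x.1.1 u v * c (G x.1.2) x.1.1 u v) ^ (N / x.1.1)) (N := N) ?_ ?_ (by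
      exact_mod_cast hN0.ne') ?_ ?_
  · refine continuous_finsetSum _ fun x _ => Continuous.pow ?_ _
    exact (hcc _ (hF _) _).mul (hcc _ (hG _) _)
  · intro u v huv
    obtain ⟨α, hα⟩ := hFG u v huv
    have e : ∑ x ∈ S, (c (F x.1.2) x.1.1 u v * c (G x.1.2) x.1.1 u v) ^ (N / x.1.1)
        = Complex.exp (N * α * Complex.I) *
          ((∑ x ∈ S, (Complex.normSq (c (F x.1.2) x.1.1 u v)) ^ (N / x.1.1) : ℝ) : ℂ) := by
      push_cast
      rw [Finset.mul_sum]
      refine Finset.sum_congr rfl fun x hx => ?_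
      rw [hα, mul_left_comm, Complex.mul_conj, mul_pow, ← Complex.exp_nat_mul, ← hdvd' x hx]
      congr 2
      ring
    simp only [e]
    refine mul_ne_zero (Complex.exp_ne_zero _) ?_
    rw [Complex.ofReal_ne_zero]
    refine (Finset.sum_pos' (fun x _ => pow_nonneg (Complex.normSq_nonneg _) _) ?_).ne'
    obtain ⟨x, hxS, hx⟩ := Set.mem_iUnion₂.1 (hS (show (u, v) ∈ frames E from huv))
    exact ⟨x, hxS, pow_pos (Complex.normSq_pos.2 hx) _⟩
  · intro u v s
    rw [Finset.mul_sum]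
    refine Finset.sum_congr rfl fun x hx => ?_
    rw [hrot, hrot, mul_mul_mul_comm, mul_pow, ← Complex.exp_add, ← Complex.exp_nat_mul]
    congr 2
    push_cast
    rw [← hdvd' x hx]
    ring
  · intro u v
    simp only [hconj, map_sum, map_pow, map_mul]

end Reflections

section StarBodies

open Set Metric Topology

variable {K : Set E4}

lemma IsStarBody.isClosed (hK : IsStarBody K) : IsClosed K := hK.1.1.isClosed

lemma IsStarBody.smul_mem (hK : IsStarBody K) {x : E4} (hx : x ∈ K) {t : ℝ} (h0 : 0 ≤ t)
    (h1 : t ≤ 1) : t • x ∈ K := hK.2.1 x hx t ⟨h0, h1⟩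

lemma IsStarBody.zero_mem (hK : IsStarBody K) : (0 : E4) ∈ K := by
  obtain ⟨x, hx⟩ := hK.1.2.1
  simpa using hK.smul_mem (interior_subset hx) le_rfl zero_le_one

lemma IsStarBody.isGreatest_radialFn (hK : IsStarBody K) {θ : E4} (hθ : ‖θ‖ = 1) :
    IsGreatest {c : ℝ | c • θ ∈ K} (radialFn K θ) := by
  have hne : {c : ℝ | c • θ ∈ K}.Nonempty := ⟨0, by simpa using hK.zero_mem⟩
  obtain ⟨B, hB⟩ := hK.1.1.isBounded.exists_norm_le
  have hbdd : BddAbove {c : ℝ | c • θ ∈ K} := by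
    refine ⟨B, fun c hc => ?_⟩
    have := hB _ hc
    rw [norm_smul, hθ, mul_one] at this
    exact (le_abs_self c).trans this
  have hcl : IsClosed {c : ℝ | c • θ ∈ K} := hK.isClosed.preimage (by fun_prop)
  exact ⟨hcl.csSup_mem hne hbdd, fun c hc => le_csSup hbdd hc⟩

/-- A star body is a retract of the space along rays. -/
lemma IsStarBody.exists_retract (hK : IsStarBody K) : ∃ R : E4 → E4, Continuous R ∧
    (∀ y, R y ∈ K) ∧ ∀ y, ∃ c ∈ Icc (0 : ℝ) 1, R y = c • y ∧
      ∀ t ∈ Icc (0 : ℝ) 1, t • y ∈ K → t ≤ c := by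
  have hunit : ∀ y : E4, y ≠ 0 → ‖‖y‖⁻¹ • y‖ = 1 := fun y hy => by
    rw [norm_smul, norm_inv, norm_norm, inv_mul_cancel₀ (norm_ne_zero_iff.2 hy)]
  have hρ : ∀ y : E4, y ≠ 0 → 0 ≤ radialFn K (‖y‖⁻¹ • y) := fun y hy =>
    (hK.isGreatest_radialFn (hunit y hy)).2 (by simpa using hK.zero_mem)
  have hmin : ∀ y : E4, y ≠ 0 → 0 ≤ min ‖y‖ (radialFn K (‖y‖⁻¹ • y)) := fun y hy =>
    le_min (norm_nonneg y) (hρ y hy)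
  refine ⟨fun y => min ‖y‖ (radialFn K (‖y‖⁻¹ • y)) • ‖y‖⁻¹ • y, ?_, fun y => ?_, fun y => ?_⟩
  · rw [continuous_iff_continuousAt]
    intro y
    by_cases hy : y = 0
    · subst hy
      rw [ContinuousAt, smul_zero, smul_zero]
      refine squeeze_zero_norm (a := fun y => ‖y‖) (fun y => ?_)
        (by simpa using continuous_norm.tendsto (0 : E4))
      by_cases hy : y = 0
      · simp [hy]
      · rw [norm_smul, hunit y hy, mul_one, Real.norm_of_nonneg (hmin y hy)]
        exact min_le_left _ _
    · have h1 : ContinuousAt (fun y : E4 => ‖y‖⁻¹ • y) y :=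
        (continuous_norm.continuousAt.inv₀ (norm_ne_zero_iff.2 hy)).smul continuousAt_id
      have h2 : ContinuousAt (fun y : E4 => radialFn K (‖y‖⁻¹ • y)) y := by
        have h3 : Filter.Tendsto (fun y : E4 => ‖y‖⁻¹ • y) (𝓝 y) (𝓝[sph] (‖y‖⁻¹ • y)) := by
          refine tendsto_nhdsWithin_iff.2 ⟨h1, ?_⟩
          filter_upwards [isOpen_ne.mem_nhds hy] with x hx
          exact mem_sphere_zero_iff_norm.2 (hunit x hx)
        exact (hK.2.2 _ (mem_sphere_zero_iff_norm.2 (hunit y hy))).tendsto.comp h3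
      exact (continuous_norm.continuousAt.min h2).smul h1
  · by_cases hy : y = 0
    · simpa [hy] using hK.zero_mem
    · have h1 := hK.isGreatest_radialFn (hunit y hy)
      by_cases h0 : radialFn K (‖y‖⁻¹ • y) = 0
      · have : min ‖y‖ (radialFn K (‖y‖⁻¹ • y)) = 0 := by
          rw [h0]; exact min_eq_right (norm_nonneg y)
        beta_reduce
        rw [this, zero_smul]
        exact hK.zero_mem
      · have hpos := lt_of_le_of_ne (hρ y hy) (Ne.symm h0)
        have := hK.smul_mem h1.1 (div_nonneg (hmin y hy) hpos.le)
          ((div_le_one hpos).2 (min_le_right _ _))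
        rwa [smul_smul, div_mul_cancel₀ _ h0] at this
  · by_cases hy : y = 0
    · exact ⟨1, ⟨zero_le_one, le_rfl⟩, by simp [hy], fun t ht _ => ht.2⟩
    · have hny : 0 < ‖y‖ := norm_pos_iff.2 hy
      refine ⟨min ‖y‖ (radialFn K (‖y‖⁻¹ • y)) * ‖y‖⁻¹, ⟨by have := hmin y hy; positivity, ?_⟩,
        smul_smul _ _ _, fun t ht hty => ?_⟩
      · rw [← div_eq_mul_inv, div_le_one hny]; exact min_le_left _ _
      · rw [← div_eq_mul_inv, le_div_iff₀ hny]
        refine le_min (by nlinarith [ht.2]) ((hK.isGreatest_radialFn (hunit y hy)).2 ?_)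
        rwa [mem_ofPred_eq, smul_smul, mul_assoc, mul_inv_cancel₀ hny.ne', mul_one]

/-- The distance from `x` to the part of `A` on the segment from the origin to `x`. -/
def rayGap (A : Set E4) (x : E4) : ℝ := infDist x (A ∩ segment ℝ 0 x)

lemma mem_segment_zero {x y : E4} : y ∈ segment ℝ 0 x ↔ ∃ t ∈ Icc (0 : ℝ) 1, t • x = y := by
  rw [segment_eq_image]
  simp

lemma IsStarBody.continuous_rayGap (hK : IsStarBody K) : Continuous (rayGap K) := by
  obtain ⟨R, hR, hRK, hc⟩ := hK.exists_retract
  have : rayGap K = fun x => dist x (R x) := by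
    funext x
    obtain ⟨c, hc1, hc2, hc3⟩ := hc x
    have hmem : R x ∈ K ∩ segment ℝ 0 x := ⟨hRK x, mem_segment_zero.2 ⟨c, hc1, hc2.symm⟩⟩
    refine le_antisymm (infDist_le_dist_of_mem hmem) ((le_infDist ⟨_, hmem⟩).2 ?_)
    rintro y ⟨hy, hy2⟩
    obtain ⟨t, ht, rfl⟩ := mem_segment_zero.1 hy2
    have key : ∀ t ∈ Icc (0 : ℝ) 1, dist x (t • x) = (1 - t) * ‖x‖ := by
      intro t ht
      rw [dist_eq_norm, ← one_smul ℝ x, smul_smul, mul_one, ← sub_smul, norm_smul, one_smul,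
        Real.norm_of_nonneg (by linarith [ht.2])]
    rw [hc2, key c hc1, key t ht]
    have := hc3 t ht hy
    gcongr
  rw [this]
  fun_prop

lemma rayGap_eq_zero_iff {A : Set E4} (hA : IsClosed A) (h0 : (0 : E4) ∈ A) {x : E4} :
    rayGap A x = 0 ↔ x ∈ A := by
  have hc : IsClosed (A ∩ segment ℝ 0 x) := by
    refine hA.inter ?_
    rw [segment_eq_image]
    exact (isCompact_Icc.image (by fun_prop)).isClosed
  rw [rayGap, ← hc.mem_iff_infDist_zero ⟨0, h0, left_mem_segment ℝ 0 x⟩]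
  exact ⟨fun h => h.1, fun h => ⟨h, right_mem_segment ℝ 0 x⟩⟩

lemma rayGap_map {A B : Set E4} {φ : E4 →L[ℝ] E4} (hφ : ∀ x, ‖φ x‖ = ‖x‖) {x : E4}
    (h : ∀ t : ℝ, t • x ∈ A ↔ φ (t • x) ∈ B) : rayGap B (φ x) = rayGap A x := by
  have hi : Isometry φ := AddMonoidHomClass.isometry_of_norm φ hφ
  rw [rayGap, rayGap, ← infDist_image hi (x := x)]
  congr 1
  ext y
  rw [mem_inter_iff, mem_segment_zero, mem_image]
  constructor
  · rintro ⟨hy, t, ht, rfl⟩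
    exact ⟨t • x, ⟨(h t).2 (by rwa [map_smul]), mem_segment_zero.2 ⟨t, ht, rfl⟩⟩, map_smul _ _ _⟩
  · rintro ⟨_, ⟨hy, hy2⟩, rfl⟩
    obtain ⟨t, ht, rfl⟩ := mem_segment_zero.1 hy2
    exact ⟨(h t).1 hy, t, ht, (map_smul _ _ _).symm⟩

end StarBodies

section Frames

open Set Metric Topology Real

lemma finrank_E4 : Module.finrank ℝ E4 = 4 := by simp [E4]

lemma exists_unit_orth_three (x y z : E4) :
    ∃ w : E4, ‖w‖ = 1 ∧ ⟪w, x⟫ = 0 ∧ ⟪w, y⟫ = 0 ∧ ⟪w, z⟫ = 0 := by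
  set S : Submodule ℝ E4 := Submodule.span ℝ ({x, y, z} : Finset E4) with hS
  have h1 : Module.finrank ℝ S ≤ 3 :=
    (finrank_span_finset_le_card _).trans Finset.card_le_three
  have h2 := S.finrank_add_finrank_orthogonal
  rw [finrank_E4] at h2
  have : Nontrivial Sᗮ := Module.nontrivial_of_finrank_pos (R := ℝ) (by omega)
  obtain ⟨w, hw⟩ := exists_norm_eq (Sᗮ) zero_le_one
  have hm : ∀ p ∈ S, ⟪(w : E4), p⟫ = 0 := fun p hp =>
    Submodule.inner_left_of_mem_orthogonal hp w.2
  exact ⟨w, hw, hm _ (Submodule.subset_span (by simp)), hm _ (Submodule.subset_span (by simp)),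
    hm _ (Submodule.subset_span (by simp))⟩

lemma exists_basis_two {ζ w : E4} (h : IsFrame ζ w) :
    ∃ b : OrthonormalBasis (Fin 4) ℝ E4, b 0 = ζ ∧ b 1 = w := by
  have ho : Orthonormal ℝ (({0, 1} : Set (Fin 4)).domRestrict ![ζ, w, 0, 0]) := by
    constructor
    · rintro ⟨i, rfl | rfl⟩
      · exact h.1
      · exact h.2.1
    · rintro ⟨i, rfl | rfl⟩ ⟨j, rfl | rfl⟩ hij
      · exact (hij rfl).elim
      · exact h.2.2
      · exact (real_inner_comm _ _).trans h.2.2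
      · exact (hij rfl).elim
  obtain ⟨b, hb⟩ := ho.exists_orthonormalBasis_extension_of_card_eq (by simp)
  exact ⟨b, hb 0 (by simp), hb 1 (by simp)⟩

lemma exists_basis_four {ζ w u v : E4} (h : IsFrame ζ w) (h' : IsFrame u v) (hu : ⟪ζ, u⟫ = 0)
    (hv : ⟪ζ, v⟫ = 0) (hwu : ⟪w, u⟫ = 0) (hwv : ⟪w, v⟫ = 0) :
    ∃ b : OrthonormalBasis (Fin 4) ℝ E4, b 0 = ζ ∧ b 1 = w ∧ b 2 = u ∧ b 3 = v := by
  have ho : Orthonormal ℝ ![ζ, w, u, v] := by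
    rw [orthonormal_iff_ite]
    intro i j
    fin_cases i <;> fin_cases j <;>
      simp [h.1, h.2.1, h'.1, h'.2.1, h.2.2, h'.2.2, hu, hv, hwu, hwv,
        real_inner_comm ζ w, real_inner_comm ζ u, real_inner_comm ζ v, real_inner_comm w u,
        real_inner_comm w v, real_inner_comm u v]
  have hcard : Fintype.card (Fin 4) = Module.finrank ℝ E4 := by rw [finrank_E4, Fintype.card_fin]
  have ho' : Orthonormal ℝ (basisOfOrthonormalOfCardEqFinrank ho hcard) := by
    rwa [coe_basisOfOrthonormalOfCardEqFinrank]
  refine ⟨(basisOfOrthonormalOfCardEqFinrank ho hcard).toOrthonormalBasis ho', ?_, ?_, ?_, ?_⟩ <;>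
    simp

variable (b : OrthonormalBasis (Fin 4) ℝ E4)

lemma OrthonormalBasis.expand (x : E4) :
    x = ⟪b 0, x⟫ • b 0 + ⟪b 1, x⟫ • b 1 + ⟪b 2, x⟫ • b 2 + ⟪b 3, x⟫ • b 3 := by
  conv_lhs => rw [← b.sum_repr' x]
  simp [Fin.sum_univ_succ, add_assoc]

lemma OrthonormalBasis.isFrame {i j : Fin 4} (h : i ≠ j) : IsFrame (b i) (b j) :=
  ⟨b.norm_eq_one i, b.norm_eq_one j, b.inner_eq_zero h⟩

lemma det_of_block {φ : E4 →ₗ[ℝ] E4} {ε c d e f : ℝ} (h0 : φ (b 0) = ε • b 0) (h1 : φ (b 1) = b 1)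
    (h2 : φ (b 2) = c • b 2 + d • b 3) (h3 : φ (b 3) = e • b 2 + f • b 3) :
    LinearMap.det φ = ε * (c * f - d * e) := by
  have hM : LinearMap.toMatrix b.toBasis b.toBasis φ
      = !![ε, 0, 0, 0; 0, 1, 0, 0; 0, 0, c, e; 0, 0, d, f] := by
    ext i j
    rw [LinearMap.toMatrix_apply]
    fin_cases j <;> fin_cases i <;>
      simp [h0, h1, h2, h3]
  rw [← LinearMap.det_toMatrix b.toBasis, hM]
  simp [Matrix.det_succ_row_zero, Fin.sum_univ_succ, Fin.succAbove]
  left; ring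

/-- A rotation fixing `b 1` and preserving the line of `b 0` acts on the plane of `b 2` and `b 3`
as a rotation or as a reflection, according to its action on `b 0`. -/
lemma exists_angle {φ : E4 →L[ℝ] E4} (hφ : ∀ x, ‖φ x‖ = ‖x‖) {ε : ℝ} (hε : ε = 1 ∨ ε = -1)
    (h0 : φ (b 0) = ε • b 0) (h1 : φ (b 1) = b 1) (hdet : LinearMap.det (φ : E4 →ₗ[ℝ] E4) = 1) :
    ∃ α, ∀ t, φ (circ (b 2) (b 3) t) = circ (b 2) (b 3) (α + ε * t) := by
  have hin : ∀ x y, ⟪φ x, φ y⟫ = ⟪x, y⟫ := fun x y =>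
    LinearIsometry.inner_map_map (⟨(φ : E4 →ₗ[ℝ] E4), hφ⟩ : E4 →ₗᵢ[ℝ] E4) x y
  have hε2 : ε * ε = 1 := by rcases hε with rfl | rfl <;> norm_num
  have hε0 : ε ≠ 0 := left_ne_zero_of_mul_eq_one hε2
  have horth : ∀ x, ⟪b 0, x⟫ = 0 → ⟪b 1, x⟫ = 0 →
      φ x = ⟪b 2, φ x⟫ • b 2 + ⟪b 3, φ x⟫ • b 3 := by
    intro x hx0 hx1
    have e0 : ⟪b 0, φ x⟫ = 0 := by
      have := hin (b 0) x
      rw [h0, inner_smul_left, hx0] at this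
      exact (mul_eq_zero.1 this).resolve_left (by simpa using hε0)
    have e1 : ⟪b 1, φ x⟫ = 0 := by
      have := hin (b 1) x
      rwa [h1, hx1] at this
    conv_lhs => rw [b.expand (φ x), e0, e1]
    simp
  have i02 : ⟪b 0, b 2⟫ = 0 := b.inner_eq_zero (by decide)
  have i03 : ⟪b 0, b 3⟫ = 0 := b.inner_eq_zero (by decide)
  have i12 : ⟪b 1, b 2⟫ = 0 := b.inner_eq_zero (by decide)
  have i13 : ⟪b 1, b 3⟫ = 0 := b.inner_eq_zero (by decide)
  have i23 : ⟪b 2, b 3⟫ = 0 := b.inner_eq_zero (by decide)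
  have i32 : ⟪b 3, b 2⟫ = 0 := b.inner_eq_zero (by decide)
  have h2 := horth (b 2) i02 i12
  have h3 := horth (b 3) i03 i13
  set c := ⟪b 2, φ (b 2)⟫
  set d := ⟪b 3, φ (b 2)⟫
  set e := ⟪b 2, φ (b 3)⟫
  set f := ⟪b 3, φ (b 3)⟫
  have hd := det_of_block b (φ := (φ : E4 →ₗ[ℝ] E4)) h0 h1 h2 h3
  rw [hdet] at hd
  have q22 := hin (b 2) (b 2)
  have q33 := hin (b 3) (b 3)
  have q23 := hin (b 2) (b 3)
  rw [h2] at q22 q23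
  rw [h3] at q33 q23
  simp only [inner_add_left, inner_add_right, inner_smul_left, inner_smul_right, i23, i32,
    real_inner_self_eq_norm_sq, b.norm_eq_one, RCLike.conj_to_real] at q22 q33 q23
  have hcd : c ^ 2 + d ^ 2 = 1 := by linarith
  have he : e = -ε * d := by
    linear_combination (-e) * hcd + c * q23 + ε * d * hd + (-(d ^ 2 * e) + c * d * f) * hε2
  have hf : f = ε * c := by
    linear_combination (-f) * hcd + d * q23 - ε * c * hd - (c ^ 2 * f - c * d * e) * hε2
  have hz : ‖(⟨c, d⟩ : ℂ)‖ = 1 := by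
    rw [← sq_eq_sq₀ (norm_nonneg _) zero_le_one, ← Complex.normSq_eq_norm_sq, Complex.normSq_apply]
    linarith
  set α := Complex.arg ⟨c, d⟩ with hα
  have hc : c = cos α := by
    rw [hα, Complex.cos_arg (by rw [← norm_ne_zero_iff, hz]; exact one_ne_zero), hz, div_one]
  have hs : d = sin α := by
    rw [hα, Complex.sin_arg, hz, div_one]
  refine ⟨α, fun t => ?_⟩
  rw [circ, map_add, map_smul, map_smul, h2, h3, he, hf, hc, hs, circ]
  rcases hε with rfl | rfl
  · rw [one_mul t, cos_add, sin_add]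
    module
  · rw [neg_one_mul t, ← sub_eq_add_neg, cos_sub, sin_sub]
    module

end Frames

section Symmetries

open Set Metric Topology Real

lemma image_sect_eq_iff {w : E4} {φ : E4 ≃ₗᵢ[ℝ] E4} (hw : φ w = w) {a : E4} (ha : ⟪a, w⟫ = 0)
    {A B : Set E4} :
    φ '' sect w A = (fun x => x + a) '' sect w B ↔ ∀ x, ⟪x, w⟫ = 0 → (x ∈ A ↔ φ x - a ∈ B) := by
  have hin : ∀ x, ⟪φ x, w⟫ = ⟪x, w⟫ := fun x => by
    conv_lhs => rw [← hw]
    exact φ.inner_map_map x w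
  constructor
  · intro h x hx
    constructor
    · intro hxA
      obtain ⟨y, hy, hxy⟩ := h.subset ⟨x, ⟨hxA, hx⟩, rfl⟩
      rw [← hxy, add_sub_cancel_right]
      exact hy.1
    · intro hxB
      obtain ⟨y, hy, hxy⟩ := h.superset ⟨φ x - a, ⟨hxB,
        by rw [inner_sub_left, hin, hx, ha, sub_zero]⟩,
        sub_add_cancel _ _⟩
      rw [← φ.injective hxy]
      exact hy.1
  · intro h
    ext y
    constructor
    · rintro ⟨x, ⟨hx, hxw⟩, rfl⟩
      exact ⟨φ x - a, ⟨(h x hxw).1 hx, by rw [inner_sub_left, hin, hxw, ha, sub_zero]⟩,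
        sub_add_cancel _ _⟩
    · rintro ⟨x, ⟨hx, hxw⟩, rfl⟩
      have e : φ (φ.symm (x + a)) = x + a := φ.apply_symm_apply _
      have h1 : ⟪φ.symm (x + a), w⟫ = 0 := by rw [← hin, e, inner_add_left, hxw, ha, add_zero]
      refine ⟨φ.symm (x + a), ⟨(h _ h1).2 ?_, h1⟩, e⟩
      rwa [e, add_sub_cancel_right]

/-- Sections invariant under the half-turn around `ζ`. -/
lemma hasPiSymSet_of_halfTurn {ζ w : E4} (h : IsFrame ζ w) {K : Set E4}
    (hK : ∀ (c : ℝ) (p : E4), ⟪p, ζ⟫ = 0 → ⟪p, w⟫ = 0 → (c • ζ + p ∈ K ↔ c • ζ - p ∈ K)) :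
    HasPiSymSet w ζ (sect w K) := by
  obtain ⟨b, rfl, rfl⟩ := exists_basis_two h
  set S : Submodule ℝ E4 := Submodule.span ℝ {b 0, b 1} with hS
  have hfix : ∀ x ∈ S, S.reflection x = x := fun x hx =>
    Submodule.reflection_mem_subspace_eq_self hx
  have hneg : ∀ x, ⟪x, b 0⟫ = 0 → ⟪x, b 1⟫ = 0 → S.reflection x = -x := by
    intro x h0 h1
    refine Submodule.reflection_mem_subspace_orthogonalComplement_eq_neg ?_
    rw [Submodule.mem_orthogonal']
    intro y hy
    obtain ⟨c, d, rfl⟩ := Submodule.mem_span_pair.1 hy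
    rw [inner_add_right, inner_smul_right, inner_smul_right, h0, h1, mul_zero, mul_zero, add_zero]
  have f0 := hfix (b 0) (Submodule.subset_span (by simp))
  have f1 := hfix (b 1) (Submodule.subset_span (by simp))
  have f2 := hneg (b 2) (b.inner_eq_zero (by decide)) (b.inner_eq_zero (by decide))
  have f3 := hneg (b 3) (b.inner_eq_zero (by decide)) (b.inner_eq_zero (by decide))
  refine ⟨S.reflection, ⟨⟨f1, ?_⟩, f0, fun v h1 h0 => ?_⟩, 0, inner_zero_left _, ?_⟩
  · rw [det_of_block b (ε := 1) (c := -1) (d := 0) (e := 0) (f := -1)]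
    · norm_num
    · simpa using f0
    · simpa using f1
    · simpa using f2
    · simpa using f3
  · rw [hneg v h0 h1, inner_neg_left, one_mul, cos_pi, neg_one_mul]
  · refine (image_sect_eq_iff f1 (inner_zero_left _)).2 fun x hx => ?_
    have hp0 : ⟪x - ⟪x, b 0⟫ • b 0, b 0⟫ = 0 := by
      rw [inner_sub_left, inner_smul_left, real_inner_self_eq_norm_sq, b.norm_eq_one]
      simp
    have hp1 : ⟪x - ⟪x, b 0⟫ • b 0, b 1⟫ = 0 := by
      rw [inner_sub_left, inner_smul_left, h.2.2, hx]
      simp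
    have e : S.reflection x = ⟪x, b 0⟫ • b 0 - (x - ⟪x, b 0⟫ • b 0) := by
      have := hneg _ hp0 hp1
      rw [map_sub, map_smul, f0] at this
      rw [sub_eq_iff_eq_add.1 this, neg_add_eq_sub]
    have := hK ⟪x, b 0⟫ _ hp0 hp1
    rwa [add_sub_cancel, ← e, ← sub_zero (S.reflection x)] at this

/-- A rotation fixing `w` and reversing `ζ` is a half-turn around an axis orthogonal to `ζ`. -/
lemma exists_hasPiSymSet {ζ w : E4} (h : IsFrame ζ w) {K : Set E4} {χ : E4 ≃ₗᵢ[ℝ] E4}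
    (hχ : IsRot w χ) (hζ : χ ζ = -ζ) {a : E4} (ha : ⟪a, w⟫ = 0)
    (hK : ∀ x, ⟪x, w⟫ = 0 → (x ∈ K ↔ χ x - a ∈ K)) :
    ∃ u ∈ S2 ζ ∩ S2 w, HasPiSymSet w u (sect w K) := by
  obtain ⟨b, rfl, rfl⟩ := exists_basis_two h
  obtain ⟨α, hα⟩ := exists_angle b (φ := (χ : E4 →L[ℝ] E4)) χ.norm_map (ε := -1) (Or.inr rfl)
    (by simpa using hζ) hχ.1 hχ.2
  have hfr : IsFrame (b 2) (b 3) := OrthonormalBasis.isFrame b (by decide)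
  set u := circ (b 2) (b 3) (α / 2) with hu
  set v := circ (b 2) (b 3) (α / 2 + π / 2) with hv
  have huv : IsFrame u v := hfr.rotate _
  have hort : ∀ t, ⟪b 0, circ (b 2) (b 3) t⟫ = 0 ∧ ⟪b 1, circ (b 2) (b 3) t⟫ = 0 := fun t =>
    ⟨IsFrame.mul_circ (b.inner_eq_zero (by decide)) (b.inner_eq_zero (by decide)) _,
      IsFrame.mul_circ (b.inner_eq_zero (by decide)) (b.inner_eq_zero (by decide)) _⟩
  have hχu : χ u = u := by
    refine (hα (α / 2)).trans ?_
    congr 1; ring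
  have hχv : χ v = -v := by
    refine (hα (α / 2 + π / 2)).trans ?_
    rw [hv, ← circ_add_pi, ← circ_periodic]
    congr 1; ring
  have hus : u ∈ S2 (b 0) ∩ S2 (b 1) :=
    ⟨⟨mem_sphere_zero_iff_norm.2 huv.1, (real_inner_comm _ _).trans (hort _).1⟩,
      ⟨mem_sphere_zero_iff_norm.2 huv.1, (real_inner_comm _ _).trans (hort _).2⟩⟩
  refine ⟨u, hus, χ, ⟨hχ, hχu, fun x hx hxu => ?_⟩, a, ha, (image_sect_eq_iff hχ.1 ha).2 hK⟩
  obtain ⟨b', h0, h1, h2, h3⟩ := exists_basis_four h huv (hort _).1 (hort _).1 (hort _).2 (hort _).2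
  have e1 : ⟪b' 1, x⟫ = 0 := by rw [h1, real_inner_comm, hx]
  have e2 : ⟪b' 2, x⟫ = 0 := by rw [h2, real_inner_comm, hxu]
  have e := b'.expand x
  rw [e1, e2, zero_smul, zero_smul, add_zero, add_zero, h0, h3] at e
  have hχx : χ x = -x := by
    rw [e, map_add, map_smul, map_smul, hζ, hχv]
    module
  rw [hχx, inner_neg_left, one_mul, cos_pi, neg_one_mul]

end Symmetries

section Congruences

open Set Metric Topology Real

/-- `φ` is a rotation fixing `w` and mapping `ζ` to `ε • ζ`, with inverse `ψ`, which maps the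
section of `K` by `w^⊥` onto that of `L + s • ζ`. -/
structure AxisCong (K L : Set E4) (ζ : E4) (ε s : ℝ) (w : E4) (φ ψ : E4 →L[ℝ] E4) : Prop where
  norm_eq : ‖w‖ = 1
  inner_eq : ⟪ζ, w⟫ = 0
  norm_map : ∀ x, ‖φ x‖ = ‖x‖
  norm_map' : ∀ x, ‖ψ x‖ = ‖x‖
  left_inv : ∀ x, ψ (φ x) = x
  right_inv : ∀ x, φ (ψ x) = x
  map_pole : φ w = w
  map_axis : φ ζ = ε • ζ
  det_eq : φ.det = 1
  mem : ∀ x, ⟪x, w⟫ = 0 → x ∈ K → φ x - s • ζ ∈ L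
  mem' : ∀ y, ⟪y, w⟫ = 0 → y ∈ L → ψ (y + s • ζ) ∈ K

variable {K L : Set E4} {ζ w : E4} {ε s : ℝ} {φ ψ : E4 →L[ℝ] E4}

lemma AxisCong.map_pole' (h : AxisCong K L ζ ε s w φ ψ) : ψ w = w := by
  conv_lhs => rw [← h.map_pole]
  exact h.left_inv w

lemma AxisCong.inner_map (h : AxisCong K L ζ ε s w φ ψ) (x y : E4) : ⟪φ x, φ y⟫ = ⟪x, y⟫ :=
  LinearIsometry.inner_map_map (⟨(φ : E4 →ₗ[ℝ] E4), h.norm_map⟩ : E4 →ₗᵢ[ℝ] E4) x y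

lemma AxisCong.inner_map_pole (h : AxisCong K L ζ ε s w φ ψ) (x : E4) : ⟪φ x, w⟫ = ⟪x, w⟫ := by
  conv_lhs => rw [← h.map_pole]
  exact h.inner_map x w

lemma AxisCong.mem_iff (h : AxisCong K L ζ ε s w φ ψ) {x : E4} (hx : ⟪x, w⟫ = 0) :
    x ∈ K ↔ φ x - s • ζ ∈ L := by
  refine ⟨h.mem x hx, fun hL => ?_⟩
  have := h.mem' _ (by rw [inner_sub_left, h.inner_map_pole, hx, inner_smul_left, h.inner_eq,
    mul_zero, sub_zero]) hL
  rwa [sub_add_cancel, h.left_inv] at this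

/-- The set of all axis-preserving congruences of sections. -/
def axisCongs (K L : Set E4) (ζ : E4) (ε s : ℝ) : Set (E4 × (E4 →L[ℝ] E4) × (E4 →L[ℝ] E4)) :=
  {g | AxisCong K L ζ ε s g.1 g.2.1 g.2.2}

lemma isClosed_axisCongs (hK : IsStarBody K) (hL : IsStarBody L) (ζ : E4) (ε s : ℝ) :
    IsClosed (axisCongs K L ζ ε s) := by
  obtain ⟨R, hR, hRK, hRc⟩ := hK.exists_retract
  obtain ⟨Q, hQ, hQL, hQc⟩ := hL.exists_retract
  have hfix : ∀ {A : Set E4} {T : E4 → E4} {y : E4}, (∃ c ∈ Icc (0 : ℝ) 1, T y = c • y ∧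
      ∀ t ∈ Icc (0 : ℝ) 1, t • y ∈ A → t ≤ c) → y ∈ A → T y = y := by
    rintro A T y ⟨c, hc, hT, hm⟩ hy
    have := hm 1 ⟨zero_le_one, le_rfl⟩ (by rwa [one_smul])
    rw [hT, le_antisymm hc.2 this, one_smul]
  have hproj : ∀ w x : E4, ‖w‖ = 1 → ⟪x - ⟪x, w⟫ • w, w⟫ = 0 := by
    intro w x hw
    rw [inner_sub_left, inner_smul_left, real_inner_self_eq_norm_sq, hw]
    simp
  have hline : ∀ {T : E4 → E4} {P : ℝ → Prop} {y w : E4}, (∃ c ∈ Icc (0 : ℝ) 1, T y = c • y ∧ P c) →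
      ⟪y, w⟫ = 0 → ⟪T y, w⟫ = 0 := by
    rintro T P y w ⟨c, -, hT, -⟩ hy
    rw [hT, inner_smul_left, hy, mul_zero]
  have e : axisCongs K L ζ ε s = {g | ‖g.1‖ = 1 ∧ ⟪ζ, g.1⟫ = 0 ∧ (∀ x, ‖g.2.1 x‖ = ‖x‖) ∧
      (∀ x, ‖g.2.2 x‖ = ‖x‖) ∧ (∀ x, g.2.2 (g.2.1 x) = x) ∧ (∀ x, g.2.1 (g.2.2 x) = x) ∧
      g.2.1 g.1 = g.1 ∧ g.2.1 ζ = ε • ζ ∧ g.2.1.det = 1 ∧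
      (∀ x, g.2.1 (R (x - ⟪x, g.1⟫ • g.1)) - s • ζ ∈ L) ∧
      (∀ y, g.2.2 (Q (y - ⟪y, g.1⟫ • g.1) + s • ζ) ∈ K)} := by
    ext ⟨w, φ, ψ⟩
    constructor
    · intro h
      refine ⟨h.1, h.2, h.3, h.4, h.5, h.6, h.7, h.8, h.9, fun x => ?_, fun x => ?_⟩
      · exact h.10 _ (hline (hRc _) (hproj w x h.1)) (hRK _)
      · exact h.11 _ (hline (hQc _) (hproj w x h.1)) (hQL _)
    · rintro ⟨h1, h2, h3, h4, h5, h6, h7, h8, h9, h10, h11⟩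
      refine ⟨h1, h2, h3, h4, h5, h6, h7, h8, h9, fun x hx hxK => ?_, fun x hx hxL => ?_⟩
      · have := h10 x
        rwa [hx, zero_smul, sub_zero, hfix (hRc x) hxK] at this
      · have := h11 x
        rwa [hx, zero_smul, sub_zero, hfix (hQc x) hxL] at this
  rw [e]
  simp only [ofPred_and, ofPred_forall]
  have c1 : Continuous fun g : E4 × (E4 →L[ℝ] E4) × (E4 →L[ℝ] E4) => g.2.1.det :=
    ContinuousLinearMap.continuous_det.comp (by fun_prop)
  refine (isClosed_eq (by fun_prop) (by fun_prop)).inter ?_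
  refine (isClosed_eq (by fun_prop) (by fun_prop)).inter ?_
  refine (isClosed_iInter fun x => isClosed_eq (by fun_prop) (by fun_prop)).inter ?_
  refine (isClosed_iInter fun x => isClosed_eq (by fun_prop) (by fun_prop)).inter ?_
  refine (isClosed_iInter fun x => isClosed_eq (by fun_prop) (by fun_prop)).inter ?_
  refine (isClosed_iInter fun x => isClosed_eq (by fun_prop) (by fun_prop)).inter ?_
  refine (isClosed_eq (by fun_prop) (by fun_prop)).inter ?_
  refine (isClosed_eq (by fun_prop) (by fun_prop)).inter ?_
  refine (isClosed_eq c1 (by fun_prop)).inter ?_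
  refine (isClosed_iInter fun x => hL.isClosed.preimage (by fun_prop)).inter ?_
  exact isClosed_iInter fun x => hK.isClosed.preimage (by fun_prop)

lemma isCompact_axisCongs (hK : IsStarBody K) (hL : IsStarBody L) (ζ : E4) (ε s : ℝ) :
    IsCompact (axisCongs K L ζ ε s) := by
  have : ProperSpace (E4 × (E4 →L[ℝ] E4) × (E4 →L[ℝ] E4)) := FiniteDimensional.proper ℝ _
  refine isCompact_of_isClosed_isBounded (isClosed_axisCongs hK hL ζ ε s) ?_
  refine (isBounded_closedBall (x := 0) (r := 1)).subset fun g hg => ?_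
  rw [mem_closedBall_zero_iff, Prod.norm_def, Prod.norm_def]
  refine max_le hg.norm_eq.le (max_le ?_ ?_)
  · exact ContinuousLinearMap.opNorm_le_bound _ zero_le_one fun x => by rw [hg.norm_map, one_mul]
  · exact ContinuousLinearMap.opNorm_le_bound _ zero_le_one fun x => by rw [hg.norm_map', one_mul]

lemma isClosed_poles (hK : IsStarBody K) (hL : IsStarBody L) (ζ : E4) (ε s : ℝ) :
    IsClosed {w | ∃ φ ψ, AxisCong K L ζ ε s w φ ψ} := by
  have := ((isCompact_axisCongs hK hL ζ ε s).image continuous_fst).isClosed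
  convert this using 1
  ext w
  constructor
  · rintro ⟨φ, ψ, h⟩
    exact ⟨(w, φ, ψ), h, rfl⟩
  · rintro ⟨⟨w, φ, ψ⟩, h, rfl⟩
    exact ⟨φ, ψ, h⟩

end Congruences

section GenericSections

open Set Metric Topology Real

variable {K L : Set E4} {ζ : E4}

lemma isFrame_of_mem_S2 {w : E4} (hζ : ‖ζ‖ = 1) (hw : w ∈ S2 ζ) : IsFrame ζ w :=
  ⟨hζ, mem_sphere_zero_iff_norm.1 hw.1, (real_inner_comm _ _).trans hw.2⟩

lemma segment_subset_of_map {A B : Set E4} {φ : E4 ≃ₗᵢ[ℝ] E4} {a w z y : E4}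
    (h : ∀ x, ⟪x, w⟫ = 0 → x ∈ A → φ x - a ∈ B) (hz : ⟪z, w⟫ = 0) (hy : ⟪y, w⟫ = 0)
    (hs : segment ℝ z y ⊆ A) : segment ℝ (φ z - a) (φ y - a) ⊆ B := by
  rintro _ ⟨c, d, hc, hd, hcd, rfl⟩
  have e : c • (φ z - a) + d • (φ y - a) = φ (c • z + d • y) - a := by
    rw [map_add, map_smul, map_smul]
    rw [smul_sub, smul_sub, sub_add_sub_comm, ← add_smul, hcd, one_smul]
  rw [e]
  refine h _ ?_ (hs ⟨c, d, hc, hd, hcd, rfl⟩)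
  rw [inner_add_left, inner_smul_left, inner_smul_left, hz, hy, mul_zero, mul_zero, add_zero]

lemma chordSup_eq (hcong : ∀ w ∈ S2 ζ, DirCong w (sect w K) (sect w L)) :
    chordSup K = chordSup L := by
  rw [chordSup, chordSup]
  congr 1
  ext d
  constructor
  · rintro ⟨z, y, hs, rfl⟩
    obtain ⟨w, hw, hwζ, hwz, hwy⟩ := exists_unit_orth_three ζ z y
    obtain ⟨φ, hφ, a, ha, himg⟩ := hcong w ⟨mem_sphere_zero_iff_norm.2 hw, hwζ⟩
    rw [image_sect_eq_iff hφ.1 ha] at himg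
    refine ⟨φ z - a, φ y - a, segment_subset_of_map (fun x hx => (himg x hx).1)
      ((real_inner_comm _ _).trans hwz) ((real_inner_comm _ _).trans hwy) hs, ?_⟩
    rw [dist_sub_right, φ.dist_map]
  · rintro ⟨z, y, hs, rfl⟩
    obtain ⟨w, hw, hwζ, hwz, hwy⟩ := exists_unit_orth_three ζ z y
    obtain ⟨φ, hφ, a, ha, himg⟩ := hcong w ⟨mem_sphere_zero_iff_norm.2 hw, hwζ⟩
    rw [image_sect_eq_iff hφ.1 ha] at himg
    refine ⟨φ.symm z - -φ.symm a, φ.symm y - -φ.symm a, segment_subset_of_map (w := w)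
      (fun x hx hxL => (himg _ ?_).2 ?_)
      ((real_inner_comm _ _).trans hwz) ((real_inner_comm _ _).trans hwy) hs, ?_⟩
    · rw [sub_neg_eq_add, ← map_add, ← φ.inner_map_map, φ.apply_symm_apply, hφ.1, inner_add_left,
        hx, ha, add_zero]
    · rwa [sub_neg_eq_add, ← map_add, φ.apply_symm_apply, add_sub_cancel_right]
    · rw [dist_sub_right, φ.symm.dist_map]

lemma mem_span_of_zero_mem_segment {z y : E4} (h0 : (0 : E4) ∈ segment ℝ z y) {s : ℝ}
    (hs : y - z = s • ζ) : ∃ c : ℝ, z = c • ζ := by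
  obtain ⟨c, d, -, -, hcd, h⟩ := h0
  refine ⟨-(d * s), ?_⟩
  rw [neg_smul, mul_smul, ← hs, smul_sub, neg_sub, eq_sub_iff_add_eq, ← add_right_inj (c • z),
    add_left_comm, h, add_zero, ← add_smul, hcd, one_smul]

/-- If every diameter of `L` in `w^⊥` lies on the axis, the congruence preserves the axis. -/
lemma exists_axisCong (hK : IsStarBody K) (hL : IsStarBody L) (hζ : ‖ζ‖ = 1)
    (hchord : chordSup K = chordSup L) {z y : E4} (hd : IsDiamStar K z y)
    (h0 : (0 : E4) ∈ segment ℝ z y) {s : ℝ} (hs0 : s ≠ 0) (hs : y - z = s • ζ) {w : E4}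
    (hw : w ∈ S2 ζ) (hcong : DirCong w (sect w K) (sect w L))
    (hgen : ∀ p q, IsDiamStar L p q → ⟪p, w⟫ = 0 → ⟪q, w⟫ = 0 →
      (∃ c : ℝ, p = c • ζ) ∧ ∃ c : ℝ, q = c • ζ) :
    ∃ ε : ℝ, (ε = 1 ∨ ε = -1) ∧
      ∃ φ ψ, AxisCong K L ζ ε (radialFn K (ε • ζ) - radialFn L ζ) w φ ψ := by
  obtain ⟨φ, hφ, a, ha, himg⟩ := hcong
  rw [image_sect_eq_iff hφ.1 ha] at himg
  have hfr := isFrame_of_mem_S2 hζ hw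
  obtain ⟨c, hz⟩ := mem_span_of_zero_mem_segment h0 hs
  have hy : y = (c + s) • ζ := by rw [add_smul, ← hs, ← hz]; abel
  have hzw : ⟪z, w⟫ = 0 := by rw [hz, inner_smul_left, hfr.2.2, mul_zero]
  have hyw : ⟪y, w⟫ = 0 := by rw [hy, inner_smul_left, hfr.2.2, mul_zero]
  have hin : ∀ x, ⟪φ x, w⟫ = ⟪x, w⟫ := fun x => by
    conv_lhs => rw [← hφ.1]
    exact φ.inner_map_map x w
  obtain ⟨⟨c₁, hp⟩, c₂, hq⟩ := hgen (φ z - a) (φ y - a)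
    ⟨segment_subset_of_map (fun x hx => (himg x hx).1) hzw hyw hd.1, by
      rw [dist_sub_right, φ.dist_map, hd.2, hchord]⟩
    (by rw [inner_sub_left, hin, hzw, ha, sub_zero])
    (by rw [inner_sub_left, hin, hyw, ha, sub_zero])
  set ε := s⁻¹ * (c₂ - c₁) with hεdef
  have hφζ : φ ζ = ε • ζ := by
    have h1 : s • φ ζ = (c₂ - c₁) • ζ := by
      rw [sub_smul, ← hp, ← hq, ← map_smul, ← hs, map_sub]
      abel
    rw [hεdef, mul_smul, ← h1, smul_smul, inv_mul_cancel₀ hs0, one_smul]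
  have hε : ε = 1 ∨ ε = -1 := by
    have := φ.norm_map ζ
    rw [hφζ, norm_smul, hζ, mul_one, Real.norm_eq_abs] at this
    exact eq_or_eq_neg_of_abs_eq this
  have hε2 : ε * ε = 1 := by rcases hε with h | h <;> rw [h] <;> norm_num
  obtain ⟨a₀, rfl⟩ : ∃ a₀ : ℝ, a = a₀ • ζ := by
    refine ⟨c * ε - c₁, ?_⟩
    rw [sub_smul, ← hp, mul_smul, ← hφζ, ← map_smul, ← hz]
    abel
  have ha₀ : radialFn K (ε • ζ) = radialFn L ζ + a₀ := by
    have hmem : ∀ t : ℝ, t • ε • ζ ∈ K ↔ (t - a₀) • ζ ∈ L := by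
      intro t
      rw [himg _ (by rw [inner_smul_left, inner_smul_left, hfr.2.2, mul_zero, mul_zero]), map_smul,
        map_smul, hφζ, smul_smul ε, hε2, one_smul, sub_smul]
    have h1 := hL.isGreatest_radialFn hζ
    refine (hK.isGreatest_radialFn (by rw [← hφζ, φ.norm_map, hζ])).unique ⟨?_, fun t ht => ?_⟩
    · rw [mem_ofPred_eq, hmem, add_sub_cancel_right]
      exact h1.1
    · have := h1.2 ((hmem t).1 ht)
      linarith
  rw [← sub_eq_iff_eq_add'] at ha₀
  refine ⟨ε, hε, (φ : E4 →L[ℝ] E4), (φ.symm : E4 →L[ℝ] E4), ?_⟩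
  rw [ha₀]
  exact
    { norm_eq := hfr.2.1
      inner_eq := hfr.2.2
      norm_map := φ.norm_map
      norm_map' := φ.symm.norm_map
      left_inv := φ.symm_apply_apply
      right_inv := φ.apply_symm_apply
      map_pole := hφ.1
      map_axis := hφζ
      det_eq := hφ.2
      mem := fun x hx hxK => (himg x hx).1 hxK
      mem' := fun x hx hxL => (himg _ (by
        change ⟪φ.symm (x + a₀ • ζ), w⟫ = 0
        rw [← hin, φ.apply_symm_apply, inner_add_left, hx, ha, add_zero])).2 (by
          change φ (φ.symm (x + a₀ • ζ)) - _ ∈ L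
          rwa [φ.apply_symm_apply, add_sub_cancel_right]) }

lemma finrank_orth (hζ : ‖ζ‖ = 1) : Module.finrank ℝ (ℝ ∙ ζ)ᗮ = 3 := by
  have : Fact (Module.finrank ℝ E4 = 3 + 1) := ⟨finrank_E4⟩
  exact Submodule.finrank_orthogonal_span_singleton
    (by rw [← norm_ne_zero_iff, hζ]; exact one_ne_zero)

lemma mem_S2_of_orth (w : (ℝ ∙ ζ)ᗮ) (hw : ‖w‖ = 1) : (w : E4) ∈ S2 ζ :=
  ⟨mem_sphere_zero_iff_norm.2 hw, (real_inner_comm _ _).trans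
    (Submodule.mem_orthogonal_singleton_iff_inner_right.1 w.2)⟩

/-- Almost all hyperplanes through the axis meet a countable set only on the axis. -/
lemma dense_generic {P : Set E4} (hP : P.Countable) (hPζ : ∀ x ∈ P, x ∉ (ℝ ∙ ζ)) :
    Dense {w : (ℝ ∙ ζ)ᗮ | ∀ x ∈ P, ⟪x, (w : E4)⟫ ≠ 0} := by
  have e : {w : (ℝ ∙ ζ)ᗮ | ∀ x ∈ P, ⟪x, (w : E4)⟫ ≠ 0}
      = ⋂ x ∈ P, {w : (ℝ ∙ ζ)ᗮ | ⟪x, (w : E4)⟫ ≠ 0} := by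
    ext w; simp
  rw [e]
  refine dense_biInter_of_isOpen (fun x _ => isOpen_ne_fun (by fun_prop) (by fun_prop)) hP
    fun x hx => ?_
  set f : (ℝ ∙ ζ)ᗮ →ₗ[ℝ] ℝ := (innerₛₗ ℝ x) ∘ₗ (ℝ ∙ ζ)ᗮ.subtype with hf
  have hk : LinearMap.ker f ≠ ⊤ := by
    intro h
    refine hPζ x hx ?_
    rw [← Submodule.orthogonal_orthogonal (ℝ ∙ ζ), Submodule.mem_orthogonal']
    intro w hw
    have : (⟨w, hw⟩ : (ℝ ∙ ζ)ᗮ) ∈ LinearMap.ker f := h ▸ Submodule.mem_top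
    exact this
  refine interior_eq_empty_iff_dense_compl.1 (not_nonempty_iff_eq_empty.1 fun h => hk ?_)
  exact Submodule.eq_top_of_nonempty_interior' _ h

end GenericSections

section AllSections

open Set Metric Topology Real

variable {K L : Set E4} {ζ : E4}

lemma countable_diam_endpoints (hLc : CountablyManyDiamsStar L) :
    {x | ∃ p q, IsDiamStar L p q ∧ (x = p ∨ x = q)}.Countable := by
  refine ((hLc.image Prod.fst).union (hLc.image Prod.snd)).mono ?_
  rintro x ⟨p, q, h, rfl | rfl⟩
  · exact Or.inl ⟨(x, q), h, rfl⟩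
  · exact Or.inr ⟨(p, x), h, rfl⟩

/-- A property that holds on a closed set of poles and for generic poles holds for all of them. -/
lemma mem_of_isClosed_of_generic (hLc : CountablyManyDiamsStar L) {C : Set E4} (hC : IsClosed C)
    (h : ∀ w ∈ S2 ζ, (∀ p q, IsDiamStar L p q → ⟪p, w⟫ = 0 → ⟪q, w⟫ = 0 →
      (∃ c : ℝ, p = c • ζ) ∧ ∃ c : ℝ, q = c • ζ) → w ∈ C) {w : E4} (hw : w ∈ S2 ζ) : w ∈ C := by
  have hwn : ‖w‖ = 1 := mem_sphere_zero_iff_norm.1 hw.1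
  set P := {x | ∃ p q, IsDiamStar L p q ∧ (x = p ∨ x = q)} ∩ {x | x ∉ (ℝ ∙ ζ)} with hP
  have hD := dense_generic (ζ := ζ)
      ((countable_diam_endpoints hLc).mono inter_subset_left : P.Countable)
    fun x hx => hx.2
  have hmem : w ∈ (ℝ ∙ ζ)ᗮ :=
    Submodule.mem_orthogonal_singleton_iff_inner_right.2 ((real_inner_comm _ _).trans hw.2)
  have hn0 : (⟨w, hmem⟩ : (ℝ ∙ ζ)ᗮ) ≠ 0 := by
    rw [← norm_ne_zero_iff, Submodule.coe_norm, hwn]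
    exact one_ne_zero
  have hcont : ContinuousAt (fun v : (ℝ ∙ ζ)ᗮ => ‖v‖⁻¹ • (v : E4)) ⟨w, hmem⟩ :=
    (continuous_norm.continuousAt.inv₀ (norm_ne_zero_iff.2 hn0)).smul
      continuous_subtype_val.continuousAt
  have hcl := mem_closure_image hcont (hD ⟨w, hmem⟩)
  have hsub : (fun v : (ℝ ∙ ζ)ᗮ => ‖v‖⁻¹ • (v : E4)) ''
      {v | ∀ x ∈ P, ⟪x, (v : E4)⟫ ≠ 0} ⊆ C ∪ {0} := by
    rintro _ ⟨v, hv, rfl⟩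
    by_cases hv0 : v = 0
    · right; simp [hv0]
    · left
      have hv1 : ‖v‖ ≠ 0 := norm_ne_zero_iff.2 hv0
      have hin : ∀ x : E4, ⟪x, ‖v‖⁻¹ • (v : E4)⟫ = 0 → ⟪x, (v : E4)⟫ = 0 := by
        intro x hx
        rw [inner_smul_right] at hx
        exact (mul_eq_zero.1 hx).resolve_left (inv_ne_zero hv1)
      have hspan : ∀ x, (∃ p q, IsDiamStar L p q ∧ (x = p ∨ x = q)) →
          ⟪x, ‖v‖⁻¹ • (v : E4)⟫ = 0 → ∃ c : ℝ, x = c • ζ := by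
        intro x hx hxv
        by_contra hcon
        refine hv x ⟨hx, fun hs => hcon ?_⟩ (hin x hxv)
        obtain ⟨c, hc⟩ := Submodule.mem_span_singleton.1 hs
        exact ⟨c, hc.symm⟩
      refine h _ ?_ fun p q hpq hp hq =>
        ⟨hspan p ⟨p, q, hpq, Or.inl rfl⟩ hp, hspan q ⟨p, q, hpq, Or.inr rfl⟩ hq⟩
      have := mem_S2_of_orth (‖v‖⁻¹ • v)
        (by rw [norm_smul, norm_inv, norm_norm, inv_mul_cancel₀ hv1])
      exact this
  have := closure_minimal hsub (hC.union isClosed_singleton) hcl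
  simp only [Submodule.coe_norm, hwn, inv_one, one_smul] at this
  refine this.resolve_right fun h0 => ?_
  rw [mem_singleton_iff.1 h0, norm_zero] at hwn
  exact zero_ne_one hwn

lemma isPreconnected_S2 (hζ : ‖ζ‖ = 1) : IsPreconnected (S2 ζ) := by
  have h1 : IsPreconnected (sphere (0 : (ℝ ∙ ζ)ᗮ) 1) := by
    refine isPreconnected_sphere ?_ 0 1
    rw [← Module.finrank_eq_rank, finrank_orth hζ]
    norm_num
  have h2 := h1.image _ (continuous_subtype_val (p := fun x => x ∈ (ℝ ∙ ζ)ᗮ)).continuousOn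
  convert h2 using 1
  ext w
  constructor
  · intro hw
    exact ⟨⟨w, Submodule.mem_orthogonal_singleton_iff_inner_right.2
      ((real_inner_comm _ _).trans hw.2)⟩, mem_sphere_zero_iff_norm.2
        (mem_sphere_zero_iff_norm.1 hw.1), rfl⟩
  · rintro ⟨v, hv, rfl⟩
    exact mem_S2_of_orth v (mem_sphere_zero_iff_norm.1 hv)

lemma S2_nonempty (ζ : E4) : (S2 ζ).Nonempty := by
  obtain ⟨w, h1, h2, -⟩ := exists_unit_orth_three ζ ζ ζ
  exact ⟨w, mem_sphere_zero_iff_norm.2 h1, h2⟩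

/-- A linear isometry of the space given together with its inverse. -/
def AxisCong.equiv {ε s : ℝ} {w : E4} {φ ψ : E4 →L[ℝ] E4} (h : AxisCong K L ζ ε s w φ ψ) :
    E4 ≃ₗᵢ[ℝ] E4 where
  toFun := φ
  invFun := ψ
  map_add' := map_add φ
  map_smul' := map_smul φ
  left_inv := h.left_inv
  right_inv := h.right_inv
  norm_map' := h.norm_map

/-- Congruences preserving and reversing the axis produce a symmetry of the section. -/
lemma AxisCong.exists_symmetry {s s' : ℝ} {w : E4} {φ ψ φ' ψ' : E4 →L[ℝ] E4}
    (h : AxisCong K L ζ 1 s w φ ψ) (h' : AxisCong K L ζ (-1) s' w φ' ψ') (hζ : ‖ζ‖ = 1) :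
    ∃ u ∈ S2 ζ ∩ S2 w, HasPiSymSet w u (sect w K) := by
  have hψζ : ψ ζ = ζ := by
    conv_lhs => rw [← one_smul ℝ ζ, ← h.map_axis]
    exact h.left_inv ζ
  have hχ : ∀ x, (h'.equiv.trans h.equiv.symm) x = ψ (φ' x) := fun x => rfl
  refine exists_hasPiSymSet (χ := h'.equiv.trans h.equiv.symm) (a := (s' - s) • ζ)
    ⟨hζ, h.norm_eq, h.inner_eq⟩ ⟨?_, ?_⟩ ?_ ?_ fun x hx => ?_
  · rw [hχ, h'.map_pole, h.map_pole']
  · have e1 : LinearMap.det (φ' : E4 →ₗ[ℝ] E4) = 1 := h'.det_eq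
    have e2 : LinearMap.det (ψ : E4 →ₗ[ℝ] E4) = 1 := by
      have e3 : LinearMap.det (φ : E4 →ₗ[ℝ] E4) = 1 := h.det_eq
      have e4 : (ψ : E4 →ₗ[ℝ] E4) ∘ₗ (φ : E4 →ₗ[ℝ] E4) = LinearMap.id :=
        LinearMap.ext h.left_inv
      have := congrArg LinearMap.det e4
      rwa [LinearMap.det_comp, e3, mul_one, LinearMap.det_id] at this
    have e5 := LinearMap.det_comp (ψ : E4 →ₗ[ℝ] E4) (φ' : E4 →ₗ[ℝ] E4)
    rw [e1, e2, mul_one] at e5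
    exact e5
  · rw [hχ, h'.map_axis, neg_one_smul, map_neg, hψζ]
  · rw [inner_smul_left, h.inner_eq, mul_zero]
  · have hχx : ⟪ψ (φ' x), w⟫ = 0 := by
      rw [← h.inner_map_pole, h.right_inv, h'.inner_map_pole, hx]
    have e : φ (ψ (φ' x) - (s' - s) • ζ) - s • ζ = φ' x - s' • ζ := by
      rw [map_sub, h.right_inv, map_smul, h.map_axis]
      module
    rw [hχ, h'.mem_iff hx, h.mem_iff (x := ψ (φ' x) - (s' - s) • ζ), e]
    rw [inner_sub_left, hχx, inner_smul_left, h.inner_eq, mul_zero, sub_zero]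

/-- Either all the congruences of sections preserve the axis or all of them reverse it. -/
lemma forall_axisCong (hK : IsStarBody K) (hL : IsStarBody L) (hLc : CountablyManyDiamsStar L)
    (hζ : ‖ζ‖ = 1)
    (hd : ∃ z y : E4, IsDiamStar K z y ∧ (0 : E4) ∈ segment ℝ z y ∧
      ∃ s : ℝ, s ≠ 0 ∧ y - z = s • ζ)
    (hcong : ∀ w ∈ S2 ζ, DirCong w (sect w K) (sect w L))
    (hsym : ∀ w ∈ S2 ζ, ∀ u ∈ S2 ζ ∩ S2 w, ¬ HasPiSymSet w u (sect w K)) :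
    ∃ ε s : ℝ, (ε = 1 ∨ ε = -1) ∧ ∀ w ∈ S2 ζ, ∃ φ ψ, AxisCong K L ζ ε s w φ ψ := by
  obtain ⟨z, y, hzy, h0, s, hs0, hs⟩ := hd
  set W : ℝ → Set E4 := fun ε =>
    {w | ∃ φ ψ, AxisCong K L ζ ε (radialFn K (ε • ζ) - radialFn L ζ) w φ ψ} with hW
  have hWc : ∀ ε, IsClosed (W ε) := fun ε => isClosed_poles hK hL ζ ε _
  have hcover : S2 ζ ⊆ W 1 ∪ W (-1) := fun w hw =>
    mem_of_isClosed_of_generic hLc ((hWc 1).union (hWc (-1))) (fun w hw hgen => by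
      obtain ⟨ε, rfl | rfl, h⟩ := exists_axisCong hK hL hζ (chordSup_eq hcong) hzy h0 hs0 hs hw
        (hcong w hw) hgen
      · exact Or.inl h
      · exact Or.inr h) hw
  by_contra! hcon
  obtain ⟨w₁, hw₁, h₁⟩ := hcon 1 (radialFn K ((1 : ℝ) • ζ) - radialFn L ζ) (Or.inl rfl)
  obtain ⟨w₂, hw₂, h₂⟩ := hcon (-1) (radialFn K ((-1 : ℝ) • ζ) - radialFn L ζ) (Or.inr rfl)
  obtain ⟨w, hw, ⟨φ, ψ, h⟩, φ', ψ', h'⟩ :=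
    isPreconnected_closed_iff.1 (isPreconnected_S2 hζ) _ _ (hWc 1) (hWc (-1)) hcover
    ⟨w₂, hw₂, (hcover hw₂).resolve_right fun ⟨φ, ψ, h⟩ => h₂ φ ψ h⟩
    ⟨w₁, hw₁, (hcover hw₁).resolve_left fun ⟨φ, ψ, h⟩ => h₁ φ ψ h⟩
  obtain ⟨u, hu, hus⟩ := h.exists_symmetry h' hζ
  exact hsym w hw u hu hus

end AllSections

section Conclusion

open Set Metric Topology Real Filter

variable {K L : Set E4} {ζ : E4}

lemma AxisCong.rayGap_eq {ε s : ℝ} {w : E4} {φ ψ : E4 →L[ℝ] E4} (h : AxisCong K L ζ ε s w φ ψ)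
    {x : E4} (hx : ⟪x, w⟫ = 0) : rayGap {y | y - s • ζ ∈ L} (φ x) = rayGap K x :=
  rayGap_map h.norm_map fun t => h.mem_iff (by rw [inner_smul_left, hx, mul_zero])

lemma AxisCong.rayGap_eq' {ε s : ℝ} {w : E4} {φ ψ : E4 →L[ℝ] E4} (h : AxisCong K L ζ ε s w φ ψ)
    {y : E4} (hy : ⟪y, w⟫ = 0) : rayGap {y | y - s • ζ ∈ L} y = rayGap K (ψ y) := by
  rw [← h.rayGap_eq (x := ψ y), h.right_inv]
  rw [← h.inner_map_pole, h.right_inv, hy]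

lemma continuous_rayGap_translate (hK : IsStarBody K) (hL : IsStarBody L) {ε s : ℝ}
    (h : ∀ w ∈ S2 ζ, ∃ φ ψ, AxisCong K L ζ ε s w φ ψ) :
    Continuous (rayGap {y | y - s • ζ ∈ L}) := by
  refine continuous_iff_seqContinuous.2 fun y y₀ hy => ?_
  have hw : ∀ n, ∃ g ∈ axisCongs K L ζ ε s, ⟪y n, g.1⟫ = 0 := by
    intro n
    obtain ⟨w, hw1, hwζ, hwy, -⟩ := exists_unit_orth_three ζ (y n) (y n)
    obtain ⟨φ, ψ, hg⟩ := h w ⟨mem_sphere_zero_iff_norm.2 hw1, hwζ⟩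
    exact ⟨(w, φ, ψ), hg, (real_inner_comm _ _).trans hwy⟩
  choose g hg hgy using hw
  refine tendsto_of_subseq_tendsto fun ns hns => ?_
  obtain ⟨g₀, hg₀, ms, hmono, hms⟩ :=
    (isCompact_axisCongs hK hL ζ ε s).tendsto_subseq fun n => hg (ns n)
  have hyl : Tendsto (fun n => y (ns (ms n))) atTop (𝓝 y₀) :=
    hy.comp (hns.comp hmono.tendsto_atTop)
  have hw0 : ⟪y₀, g₀.1⟫ = 0 := by
    refine tendsto_nhds_unique (hyl.inner ((continuous_fst.tendsto _).comp hms)) ?_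
    simp only [Function.comp, hgy]
    exact tendsto_const_nhds
  refine ⟨ms, ?_⟩
  simp only [Function.comp, fun n => (hg n).rayGap_eq' (hgy n), hg₀.rayGap_eq' hw0]
  refine (hK.continuous_rayGap.tendsto _).comp ?_
  have hψ : Tendsto (fun n => (g (ns (ms n))).2.2) atTop (𝓝 g₀.2.2) :=
    ((continuous_snd.comp continuous_snd).tendsto _).comp hms
  exact (isBoundedBilinearMap_apply.continuous.tendsto (g₀.2.2, y₀)).comp (hψ.prodMk_nhds hyl)

lemma coe_circ {S : Submodule ℝ E4} (u v : S) (t : ℝ) :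
    ((circ u v t : S) : E4) = circ (u : E4) v t := rfl

/-- The action of the congruences on the half-planes bounded by the axis. -/
lemma exists_angle_rayGap (hζ : ‖ζ‖ = 1) {ε s : ℝ} (hε : ε = 1 ∨ ε = -1)
    (h : ∀ w ∈ S2 ζ, ∃ φ ψ, AxisCong K L ζ ε s w φ ψ) {u v : (ℝ ∙ ζ)ᗮ} (huv : IsFrame u v) :
    ∃ α, ∀ (a : ℝ × ℝ) t,
      rayGap {y | y - s • ζ ∈ L} (a.1 • (circ u v (α + ε * t) : (ℝ ∙ ζ)ᗮ) + (ε * a.2) • ζ)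
        = rayGap K (a.1 • (circ u v t : (ℝ ∙ ζ)ᗮ) + a.2 • ζ) := by
  obtain ⟨w, hw1, hwζ, hwu, hwv⟩ := exists_unit_orth_three ζ (u : E4) v
  obtain ⟨φ, ψ, hg⟩ := h w ⟨mem_sphere_zero_iff_norm.2 hw1, hwζ⟩
  have hort : ∀ x : (ℝ ∙ ζ)ᗮ, ⟪ζ, (x : E4)⟫ = 0 := fun x =>
    Submodule.mem_orthogonal_singleton_iff_inner_right.1 x.2
  obtain ⟨b, rfl, rfl, h2, h3⟩ := exists_basis_four (ζ := ζ) (w := w) (u := u) (v := v)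
    ⟨hζ, hw1, hg.inner_eq⟩ huv (hort u) (hort v) hwu hwv
  obtain ⟨α, hα⟩ := exists_angle b hg.norm_map hε hg.map_axis hg.map_pole hg.det_eq
  refine ⟨α, fun a t => ?_⟩
  rw [← hg.rayGap_eq, map_add, map_smul, map_smul, hg.map_axis, coe_circ, coe_circ, ← h2, ← h3,
    hα, smul_smul, mul_comm a.2]
  rw [coe_circ, inner_add_left, inner_smul_left, inner_smul_left, hg.inner_eq, real_inner_comm,
    IsFrame.mul_circ hwu hwv, mul_zero, mul_zero, add_zero]

lemma exists_rayGap_ne (hK : IsStarBody K) (hζ : ‖ζ‖ = 1)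
    (hsym : ∀ w ∈ S2 ζ, ¬ HasPiSymSet w ζ (sect w K)) {u v : (ℝ ∙ ζ)ᗮ} (huv : IsFrame u v) :
    ∃ (a : ℝ × ℝ) (t : ℝ),
      rayGap K (a.1 • (circ u v (t + π) : (ℝ ∙ ζ)ᗮ) + a.2 • ζ)
        ≠ rayGap K (a.1 • (circ u v t : (ℝ ∙ ζ)ᗮ) + a.2 • ζ) := by
  by_contra! hcon
  obtain ⟨w, hw1, hwζ, hwu, hwv⟩ := exists_unit_orth_three ζ (u : E4) v
  have hwS : w ∈ S2 ζ := ⟨mem_sphere_zero_iff_norm.2 hw1, hwζ⟩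
  have hfr := isFrame_of_mem_S2 hζ hwS
  have hort : ∀ x : (ℝ ∙ ζ)ᗮ, ⟪ζ, (x : E4)⟫ = 0 := fun x =>
    Submodule.mem_orthogonal_singleton_iff_inner_right.1 x.2
  obtain ⟨b, h0, h1, h2, h3⟩ :=
    exists_basis_four hfr (u := u) (v := v) huv (hort u) (hort v) hwu hwv
  refine hsym w hwS (hasPiSymSet_of_halfTurn hfr fun c p hpζ hpw => ?_)
  obtain ⟨δ, e1, e2⟩ := exists_polar ⟪b 2, p⟫ ⟪b 3, p⟫
  set r := √(⟪b 2, p⟫ ^ 2 + ⟪b 3, p⟫ ^ 2)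
  have hp : p = r • circ (u : E4) v δ := by
    rw [b.expand p, e1, e2, h0, h1, h2, h3, real_inner_comm, hpζ, real_inner_comm p w, hpw, circ]
    module
  have := hcon (r, c) δ
  rw [circ_add_pi, Submodule.coe_neg, coe_circ, smul_neg, ← hp, add_comm, ← sub_eq_add_neg,
    add_comm p] at this
  rw [← rayGap_eq_zero_iff hK.isClosed hK.zero_mem, ← rayGap_eq_zero_iff hK.isClosed hK.zero_mem,
    this]

lemma exists_decomp (hζ : ‖ζ‖ = 1) (x : E4) :
    ∃ (a : ℝ × ℝ) (θ : (ℝ ∙ ζ)ᗮ), ‖θ‖ = 1 ∧ x = a.1 • (θ : E4) + a.2 • ζ := by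
  have : Nontrivial (ℝ ∙ ζ)ᗮ :=
    Module.nontrivial_of_finrank_pos (R := ℝ) (by rw [finrank_orth hζ]; norm_num)
  have hp : x - ⟪ζ, x⟫ • ζ ∈ (ℝ ∙ ζ)ᗮ := by
    rw [Submodule.mem_orthogonal_singleton_iff_inner_right, inner_sub_right, inner_smul_right,
      real_inner_self_eq_norm_sq, hζ]
    simp
  obtain ⟨θ, hθ, c, hc⟩ : ∃ θ : (ℝ ∙ ζ)ᗮ, ‖θ‖ = 1 ∧ ∃ c : ℝ, (⟨_, hp⟩ : (ℝ ∙ ζ)ᗮ) = c • θ := by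
    by_cases h0 : (⟨_, hp⟩ : (ℝ ∙ ζ)ᗮ) = 0
    · obtain ⟨θ, hθ⟩ := exists_norm_eq (ℝ ∙ ζ)ᗮ zero_le_one
      exact ⟨θ, hθ, 0, by rw [h0, zero_smul]⟩
    · have hn := norm_ne_zero_iff.2 h0
      exact ⟨‖(⟨_, hp⟩ : (ℝ ∙ ζ)ᗮ)‖⁻¹ • ⟨_, hp⟩, by
        rw [norm_smul, norm_inv, norm_norm, inv_mul_cancel₀ hn], _, (smul_inv_smul₀ hn _).symm⟩
  refine ⟨(c, ⟪ζ, x⟫), θ, hθ, ?_⟩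
  have := congrArg (Subtype.val) hc
  rw [Submodule.coe_smul] at this
  rw [← this, sub_add_cancel]

/-- The two bodies agree up to a translation and the map `𝒪` along the axis. -/
lemma mem_translate_iff (hK : IsStarBody K) (hL : IsStarBody L) (hζ : ‖ζ‖ = 1) {ε s : ℝ}
    (hε : ε = 1 ∨ ε = -1) (h : ∀ w ∈ S2 ζ, ∃ φ ψ, AxisCong K L ζ ε s w φ ψ)
    (hsym : ∀ w ∈ S2 ζ, ¬ HasPiSymSet w ζ (sect w K)) :
    (∀ x, x ∈ K ↔ x - s • ζ ∈ L) ∨ (∀ x, Ocal ζ x ∈ K ↔ x - s • ζ ∈ L) := by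
  have hcK := hK.continuous_rayGap
  have hcL := continuous_rayGap_translate hK hL h
  have hE : 3 ≤ Module.finrank ℝ (ℝ ∙ ζ)ᗮ := (finrank_orth hζ).ge
  set F : ℝ × ℝ → (ℝ ∙ ζ)ᗮ → ℝ := fun a x => rayGap K (a.1 • (x : E4) + a.2 • ζ) with hF
  set G : ℝ × ℝ → (ℝ ∙ ζ)ᗮ → ℝ := fun a x =>
    rayGap {y | y - s • ζ ∈ L} (a.1 • (x : E4) + (ε * a.2) • ζ) with hG
  have hFc : ∀ a, Continuous (F a) := fun a => hcK.comp (by fun_prop)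
  have hGc : ∀ a, Continuous (G a) := fun a => hcL.comp (by fun_prop)
  have hcl : IsClosed {y | y - s • ζ ∈ L} := hL.isClosed.preimage (by fun_prop)
  have h0 : (0 : E4) ∈ {y | y - s • ζ ∈ L} := by
    obtain ⟨w, hw⟩ := S2_nonempty ζ
    obtain ⟨φ, ψ, hg⟩ := h w hw
    have := hg.mem 0 (inner_zero_left _) hK.zero_mem
    rwa [map_zero] at this
  have hiff : ∀ x y, rayGap {y | y - s • ζ ∈ L} x = rayGap K y → (y ∈ K ↔ x - s • ζ ∈ L) := by
    intro x y hxy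
    rw [← rayGap_eq_zero_iff hK.isClosed hK.zero_mem, ← hxy, rayGap_eq_zero_iff hcl h0]
    rfl
  rcases hε with rfl | rfl
  · have H : ∀ u v, IsFrame u v → ∃ α, ∀ a t, G a (circ u v (t + α)) = F a (circ u v t) := by
      intro u v huv
      obtain ⟨α, hα⟩ := exists_angle_rayGap hζ (Or.inl rfl) h huv
      refine ⟨α, fun a t => ?_⟩
      have := hα a t
      rw [one_mul t, add_comm α] at this
      exact this
    refine (eq_or_eq_neg_of_rotations hE hFc hGc H fun u v huv =>
      exists_rayGap_ne hK hζ hsym huv).imp (fun hFG x => hiff _ _ ?_) fun hFG x => hiff _ _ ?_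
    · obtain ⟨a, θ, hθ, rfl⟩ := exists_decomp hζ x
      simpa [hF, hG] using hFG a θ hθ
    · obtain ⟨a, θ, hθ, rfl⟩ := exists_decomp hζ x
      have e : Ocal ζ (a.1 • (θ : E4) + a.2 • ζ) = a.1 • ((-θ : (ℝ ∙ ζ)ᗮ) : E4) + a.2 • ζ := by
        have : ⟪(θ : E4), ζ⟫ = 0 := (real_inner_comm _ _).trans
          (Submodule.mem_orthogonal_singleton_iff_inner_right.1 θ.2)
        rw [Ocal, inner_add_left, inner_smul_left, inner_smul_left, this,
          real_inner_self_eq_norm_sq, hζ, Submodule.coe_neg]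
        simp only [RCLike.conj_to_real]
        module
      rw [e]
      simpa [hF, hG] using hFG a θ hθ
  · refine (false_of_reflections hE hFc hGc (fun u v huv => ?_) fun u v huv =>
      exists_rayGap_ne hK hζ hsym huv).elim
    obtain ⟨α, hα⟩ := exists_angle_rayGap hζ (Or.inr rfl) h huv
    refine ⟨α, fun a t => ?_⟩
    have := hα a t
    rw [neg_one_mul t, ← sub_eq_add_neg] at this
    exact this

end Conclusion

/-- Theorem 2: star bodies in `ℝ⁴` with directly congruent sections. -/
theorem stmt_14 (K L : Set E4) (hK : IsStarBody K) (hL : IsStarBody L)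
    (hKc : CountablyManyDiamsStar K) (hLc : CountablyManyDiamsStar L)
    (ζ : E4) (hζ : ζ ∈ sph)
    (hd : ∃ z y : E4, IsDiamStar K z y ∧ (0 : E4) ∈ segment ℝ z y ∧
      ∃ s : ℝ, s ≠ 0 ∧ y - z = s • ζ)
    (hcong : ∀ w ∈ S2 ζ, DirCong w (sect w K) (sect w L))
    (hsym : ∀ w ∈ S2 ζ,
      (¬ HasPiSymSet w ζ (sect w K) ∧ ¬ HasPiSymSet w ζ (sect w L)) ∧
      ∀ u ∈ S2 ζ ∩ S2 w, ¬ HasPiSymSet w u (sect w K) ∧ ¬ HasPiSymSet w u (sect w L)) :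
    ∃ b : E4, (∃ s : ℝ, b = s • ζ) ∧
      (K = (fun x => x + b) '' L ∨ K = (fun x => Ocal ζ x + b) '' L) := by
  have hζ1 : ‖ζ‖ = 1 := mem_sphere_zero_iff_norm.1 hζ
  obtain ⟨ε, s, hε, h⟩ := forall_axisCong hK hL hLc hζ1 hd hcong
    fun w hw u hu => ((hsym w hw).2 u hu).1
  have hO : ∀ (x : E4) (c : ℝ), Ocal ζ (Ocal ζ x - c • ζ) = x - c • ζ := by
    intro x c
    simp only [Ocal, inner_sub_left, inner_smul_left, real_inner_self_eq_norm_sq, hζ1,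
      RCLike.conj_to_real]
    module
  have hO0 : ∀ x, Ocal ζ (Ocal ζ x) = x := fun x => by simpa using hO x 0
  refine ⟨s • ζ, ⟨s, rfl⟩, ?_⟩
  refine (mem_translate_iff hK hL hζ1 hε h fun w hw => (hsym w hw).1.1).imp
    (fun hx => ?_) fun hx => ?_
  · ext x
    rw [hx]
    exact ⟨fun h => ⟨_, h, sub_add_cancel _ _⟩, by
      rintro ⟨y, hy, rfl⟩
      rwa [add_sub_cancel_right]⟩
  · ext x
    rw [← hO0 x, hx, hO0]
    refine ⟨fun h => ⟨_, h, by beta_reduce; rw [hO, sub_add_cancel]⟩, ?_⟩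
    rintro ⟨y, hy, rfl⟩
    have : Ocal ζ (Ocal ζ y + s • ζ) - s • ζ = y := by
      have := hO y (-s)
      rw [neg_smul, sub_neg_eq_add, sub_neg_eq_add] at this
      rw [this, add_sub_cancel_right]
    rwa [this]
end
end

section
/- Let K and L be star-shaped bodies with respect to the origin in ℝ⁴, having countably many diameters, such that K has a diameter d_K(ζ) containing the origin and parallel to ζ ∈ S³, and such that for every w ∈ S²(ζ) the sections K ∩ w^⊥ and L ∩ w^⊥ are directly congruent and have no (ζ, π)-symmetries and no (u, π)-symmetries for any u ∈ ζ^⊥ ∩ w^⊥ ∩ S³. Then L has a diameter parallel to ζ passing through the origin; the set Ω^r = {w ∈ S²(ζ) : (A_K ∪ A_L) ∩ S²(w) = {±ζ}} is everywhere dense in S²(ζ); for every w ∈ Ω^r, every rotation χ_w ∈ SO(3, S²(w)) satisfying χ_w(K ∩ w^⊥) = (L ∩ w^⊥) + a_w for some a_w ∈ w^⊥ maps ζ to ±ζ; and v_K(ζ) = v_L(ζ). -/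
noncomputable section

open scoped RealInnerProductSpace

lemma dist_le_chordSup {K : Set E4} (hK : IsCompact K) {z y : E4} (h : segment ℝ z y ⊆ K) :
    dist z y ≤ chordSup K := by
  obtain ⟨C, hC⟩ := Metric.isBounded_iff.1 hK.isBounded
  refine le_csSup ⟨C, ?_⟩ ⟨z, y, h, rfl⟩
  rintro d ⟨a, b, hab, rfl⟩
  exact hC (hab (left_mem_segment ℝ a b)) (hab (right_mem_segment ℝ a b))

lemma StarShapedO.smul_mem_of_le {K : Set E4} (hK : StarShapedO K) {v : E4} {c q : ℝ}
    (hq : q • v ∈ K) (hc : 0 ≤ c) (hcq : c ≤ q) : c • v ∈ K := by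
  rcases hc.eq_or_lt with rfl | hc'
  · simpa using hK _ hq 0 (by simp)
  · have hq0 : 0 < q := hc'.trans_le hcq
    have := hK _ hq (c / q) ⟨by positivity, (div_le_one hq0).2 hcq⟩
    rwa [smul_smul, div_mul_cancel₀ _ hq0.ne'] at this

lemma StarShapedO.segment_subset {K : Set E4} (hK : StarShapedO K) {v : E4} {p q : ℝ}
    (hp : 0 ≤ p) (hq : 0 ≤ q) (hpK : p • (-v) ∈ K) (hqK : q • v ∈ K) :
    segment ℝ (p • (-v)) (q • v) ⊆ K := by
  rintro _ ⟨a, b, ha, hb, hab, rfl⟩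
  have e : a • p • (-v) + b • q • v = (b * q - a * p) • v := by
    module
  rw [e]
  have h1 : 0 ≤ b * p := by positivity
  have h2 : 0 ≤ a * q := by positivity
  have h3 : 0 ≤ a * p := by positivity
  have h4 : 0 ≤ b * q := by positivity
  have ha' : a = 1 - b := by linarith
  rcases le_total 0 (b * q - a * p) with h | h
  · exact hK.smul_mem_of_le hqK h (by subst ha'; nlinarith)
  · have := hK.smul_mem_of_le (c := -(b * q - a * p)) hpK (by linarith)
      (by subst ha'; nlinarith)
    rwa [smul_neg, neg_smul, neg_neg] at this

lemma dist_smul_neg_smul {v : E4} (hv : ‖v‖ = 1) {p q : ℝ} (hp : 0 ≤ p) (hq : 0 ≤ q) :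
    dist (p • (-v)) (q • v) = p + q := by
  have e : p • (-v) - q • v = -(p + q) • v := by module
  rw [dist_eq_norm, e, norm_smul, hv, mul_one, norm_neg, Real.norm_of_nonneg (by positivity)]

/-- A radial chord of maximal length ends at the value of the radial function. -/
lemma radialFn_eq_of_maximal {K : Set E4} (hK : IsCompact K) (hs : StarShapedO K) {v : E4}
    (hv : ‖v‖ = 1) {p q : ℝ} (hp : 0 ≤ p) (hq : 0 ≤ q) (hpK : p • (-v) ∈ K)
    (hqK : q • v ∈ K) (hpq : p + q = chordSup K) : radialFn K v = q := by
  refine IsGreatest.csSup_eq ⟨hqK, fun c hc => ?_⟩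
  by_contra! h
  have hc0 : 0 ≤ c := hq.trans h.le
  have := dist_le_chordSup hK (hs.segment_subset hp hc0 hpK hc)
  rw [dist_smul_neg_smul hv hp hc0] at this
  linarith

/-- A diameter on the line `ℝ v` runs from `-p v` to `q v` for some `p, q ≥ 0`, up to order. -/
lemma IsDiamStar.exists_radial {K : Set E4} (hK : IsCompact K) (hs : StarShapedO K) {v : E4}
    (hv : ‖v‖ = 1) {a b : ℝ} (h : IsDiamStar K (a • v) (b • v)) :
    (a ≤ 0 ∧ 0 ≤ b) ∨ (b ≤ 0 ∧ 0 ≤ a) := by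
  have hd : |a - b| = chordSup K := by
    rw [← h.2, dist_eq_norm, ← sub_smul, norm_smul, hv, mul_one, Real.norm_eq_abs]
  have hmemA : a • v ∈ K := h.1 (left_mem_segment ℝ _ _)
  have hmemB : b • v ∈ K := h.1 (right_mem_segment ℝ _ _)
  have key : ∀ u : E4, ‖u‖ = 1 → ∀ c : ℝ, 0 ≤ c → c • u ∈ K → c ≤ chordSup K := by
    intro u hu c hc hcK
    have h0 : (0 : ℝ) • (-u) ∈ K := by simpa using hs _ hcK 0 (by simp)
    have := dist_le_chordSup hK (hs.segment_subset le_rfl hc h0 hcK)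
    rwa [dist_smul_neg_smul hu le_rfl hc, zero_add] at this
  have hv' : ‖-v‖ = 1 := by rwa [norm_neg]
  by_contra! hcon
  rcases lt_trichotomy a 0 with ha | ha | ha
  · have hb : b < 0 := by by_contra! hb; linarith [hcon.1 ha.le]
    have h1 := key (-v) hv' (-a) (by linarith) (by simpa using hmemA)
    have h2 := key (-v) hv' (-b) (by linarith) (by simpa using hmemB)
    rcases abs_cases (a - b) with h | h <;> linarith
  · rcases le_total 0 b with hb | hb
    · linarith [hcon.1 ha.le]
    · linarith [hcon.2 hb]
  · have hb : 0 < b := by by_contra! hb; linarith [hcon.2 hb]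
    have h1 := key v hv a (by linarith) hmemA
    have h2 := key v hv b (by linarith) hmemB
    rcases abs_cases (a - b) with h | h <;> linarith

lemma IsDiamStar.symm {K : Set E4} {z y : E4} (h : IsDiamStar K z y) : IsDiamStar K y z :=
  ⟨segment_symm ℝ z y ▸ h.1, dist_comm z y ▸ h.2⟩

lemma radialFn_add_eq_chordSup {K : Set E4} (hK : IsCompact K) (hs : StarShapedO K) {v : E4}
    (hv : ‖v‖ = 1) {a b : ℝ} (h : IsDiamStar K (a • v) (b • v)) :
    radialFn K v + radialFn K (-v) = chordSup K := by
  wlog hab : a ≤ 0 ∧ 0 ≤ b generalizing a b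
  · exact this h.symm ((h.exists_radial hK hs hv).resolve_left hab)
  have ha : (-a) • (-v) = a • v := by module
  have haK : (-a) • (-v) ∈ K := ha ▸ h.1 (left_mem_segment ℝ _ _)
  have hbK : b • v ∈ K := h.1 (right_mem_segment ℝ _ _)
  have hsum : -a + b = chordSup K := by
    rw [← h.2, ← ha, dist_smul_neg_smul hv (by linarith) hab.2]
  rw [radialFn_eq_of_maximal hK hs hv (by linarith) hab.2 haK hbK hsum,
    radialFn_eq_of_maximal (p := b) (q := -a) hK hs (by rwa [norm_neg]) hab.2 (by linarith)
      (by rwa [neg_neg]) haK (by linarith)]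
  linarith

lemma exists_unit_orthogonal (a b c : E4) :
    ∃ w ∈ sph, ⟪a, w⟫ = 0 ∧ ⟪b, w⟫ = 0 ∧ ⟪c, w⟫ = 0 := by
  let f : E4 →ₗ[ℝ] (Fin 3 → ℝ) :=
    LinearMap.pi ![(innerSL ℝ a).toLinearMap, (innerSL ℝ b).toLinearMap,
      (innerSL ℝ c).toLinearMap]
  obtain ⟨x, hx, hx0⟩ := (Submodule.ne_bot_iff _).1
    (LinearMap.ker_ne_bot_of_finrank_lt (f := f) (by simp))
  have hf : ∀ i, f x i = 0 := fun i => congrFun (LinearMap.mem_ker.1 hx) i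
  refine ⟨‖x‖⁻¹ • x, by simp [sph, norm_smul, hx0], ?_, ?_, ?_⟩
  · have := hf 0
    simp only [f, LinearMap.pi_apply] at this
    simp only [real_inner_smul_right]
    simp_all
  · have := hf 1
    simp only [f, LinearMap.pi_apply] at this
    simp only [real_inner_smul_right]
    simp_all
  · have := hf 2
    simp only [f, LinearMap.pi_apply] at this
    simp only [real_inner_smul_right]
    simp_all

/-- Countably many hyperplanes have dense complement. -/
lemma dense_inner_ne_zero {S : Set E4} (hS : S.Countable) (h0 : ∀ s ∈ S, s ≠ 0) :
    Dense {x : E4 | ∀ s ∈ S, ⟪x, s⟫ ≠ 0} := by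
  have e : {x : E4 | ∀ s ∈ S, ⟪x, s⟫ ≠ 0} = ⋂ s ∈ S, {x : E4 | ⟪x, s⟫ ≠ 0} := by
    ext; simp
  rw [e]
  refine dense_biInter_of_isOpen (fun s _ => ?_) hS fun s hs => ?_
  · exact isOpen_ne_fun (by fun_prop) (by fun_prop)
  · intro x
    have hlim : Filter.Tendsto (fun t : ℝ => x + t • s) (nhdsWithin 0 {0}ᶜ) (nhds x) := by
      have : Continuous fun t : ℝ => x + t • s := by fun_prop
      simpa using (this.tendsto 0).mono_left nhdsWithin_le_nhds
    refine mem_closure_of_tendsto (b := nhdsWithin (0 : ℝ) {0}ᶜ) hlim ?_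
    have hss : ⟪s, s⟫ ≠ 0 := inner_self_ne_zero.2 (h0 s hs)
    by_cases hx : ⟪x, s⟫ = 0
    · filter_upwards [self_mem_nhdsWithin] with t ht
      simpa [inner_add_left, real_inner_smul_left, hx] using ⟨ht, h0 s hs⟩
    · have : ∀ᶠ y in nhds x, ⟪y, s⟫ ≠ 0 :=
        (isOpen_ne_fun (f := fun y : E4 => ⟪y, s⟫) (g := fun _ => (0 : ℝ))
          (by fun_prop) (by fun_prop)).mem_nhds hx
      exact hlim.eventually this

/-- Countably many great circles have dense complement in the great sphere `S²(ζ)`. -/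
lemma S2_subset_closure_inner_ne_zero {ζ : E4} (hζ : ‖ζ‖ = 1) {S : Set E4} (hS : S.Countable)
    (hne : ∀ s ∈ S, s ≠ ⟪s, ζ⟫ • ζ) :
    S2 ζ ⊆ closure {w ∈ S2 ζ | ∀ s ∈ S, ⟪w, s⟫ ≠ 0} := by
  intro w ⟨hw, hwζ⟩
  have hw1 : ‖w‖ = 1 := by simpa [sph] using hw
  have hζζ : ⟪ζ, ζ⟫ = 1 := by rw [real_inner_self_eq_norm_sq, hζ, one_pow]
  let π : E4 → E4 := fun x => x - ⟪x, ζ⟫ • ζ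
  have hπ : Continuous π := by fun_prop
  have hπw : π w = w := by simp [π, hwζ]
  have hπi : ∀ x s, ⟪π x, s⟫ = ⟪x, π s⟫ := by
    intro x s
    simp only [π, inner_sub_left, inner_sub_right, real_inner_smul_left, real_inner_smul_right]
    rw [real_inner_comm s ζ]
    ring
  have hdense := dense_inner_ne_zero (hS.image π) (by
    rintro _ ⟨s, hs, rfl⟩
    exact sub_ne_zero.2 (hne s hs))
  let N : E4 → E4 := fun x => ‖π x‖⁻¹ • π x
  have hN : ContinuousAt N w := by
    refine ContinuousAt.smul (ContinuousAt.inv₀ hπ.norm.continuousAt ?_) hπ.continuousAt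
    rw [hπw, hw1]; exact one_ne_zero
  have hNw : N w = w := by simp [N, hπw, hw1]
  have hev : ∀ᶠ x in nhds w, π x ≠ 0 := by
    refine hπ.continuousAt.eventually_ne ?_
    rw [hπw]; exact norm_ne_zero_iff.1 (by rw [hw1]; exact one_ne_zero)
  rw [mem_closure_iff_nhds]
  intro t ht
  have ht' : N ⁻¹' t ∈ nhds w := hN (by rwa [hNw])
  obtain ⟨x, ⟨hxt, hx0⟩, hxS⟩ :=
    mem_closure_iff_nhds.1 (hdense w) _ (Filter.inter_mem ht' hev)
  have hx0' : π x ≠ 0 := hx0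
  refine ⟨N x, hxt, ⟨by simp [sph, N, norm_smul, hx0'], ?_⟩, fun s hs => ?_⟩
  · simp [N, real_inner_smul_left, π, inner_sub_left, hζ]
  · rw [real_inner_smul_left, hπi]
    exact mul_ne_zero (inv_ne_zero (norm_ne_zero_iff.2 hx0')) (hxS _ ⟨s, hs, rfl⟩)

lemma IsRot.inner_apply {w : E4} {χ : E4 ≃ₗᵢ[ℝ] E4} (h : IsRot w χ) (x : E4) :
    ⟪χ x, w⟫ = ⟪x, w⟫ := by
  conv_lhs => rw [← h.1]
  exact χ.inner_map_map x w

lemma segment_inner_eq_zero {w z y x : E4} (hz : ⟪z, w⟫ = 0) (hy : ⟪y, w⟫ = 0)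
    (hx : x ∈ segment ℝ z y) : ⟪x, w⟫ = 0 := by
  obtain ⟨a, b, -, -, -, rfl⟩ := hx
  simp [inner_add_left, real_inner_smul_left, hz, hy]

lemma segment_subset_of_image_sect_eq {K L : Set E4} {w a : E4} {χ : E4 ≃ₗᵢ[ℝ] E4}
    (h : χ '' sect w K = (fun x => x + a) '' sect w L) {z y : E4} (hz : ⟪z, w⟫ = 0)
    (hy : ⟪y, w⟫ = 0) (hzy : segment ℝ z y ⊆ K) : segment ℝ (χ z - a) (χ y - a) ⊆ L := by
  rintro _ ⟨s, t, hs, ht, hst, rfl⟩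
  have hm : s • z + t • y ∈ segment ℝ z y := ⟨s, t, hs, ht, hst, rfl⟩
  have := Set.mem_image_of_mem χ
    (show s • z + t • y ∈ sect w K from ⟨hzy hm, segment_inner_eq_zero hz hy hm⟩)
  rw [h] at this
  obtain ⟨x, hx, hxe⟩ := this
  have e : s • (χ z - a) + t • (χ y - a) = x := by
    have hxe' : x + a = s • χ z + t • χ y := by simpa using hxe
    have hs' : s = 1 - t := by linarith
    rw [eq_sub_of_add_eq hxe', hs']
    module
  exact e ▸ hx.1

lemma segment_subset_of_image_sect_eq_symm {K L : Set E4} {w a : E4} {χ : E4 ≃ₗᵢ[ℝ] E4}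
    (h : χ '' sect w K = (fun x => x + a) '' sect w L) {z y : E4} (hz : ⟪z, w⟫ = 0)
    (hy : ⟪y, w⟫ = 0) (hzy : segment ℝ z y ⊆ L) :
    segment ℝ (χ.symm (z + a)) (χ.symm (y + a)) ⊆ K := by
  rintro _ ⟨s, t, hs, ht, hst, rfl⟩
  have hm : s • z + t • y ∈ segment ℝ z y := ⟨s, t, hs, ht, hst, rfl⟩
  have := Set.mem_image_of_mem (fun x => x + a)
    (show s • z + t • y ∈ sect w L from ⟨hzy hm, segment_inner_eq_zero hz hy hm⟩)
  rw [← h] at this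
  obtain ⟨x, hx, hxe⟩ := this
  have e : s • χ.symm (z + a) + t • χ.symm (y + a) = x := by
    apply χ.injective
    have hs' : s = 1 - t := by linarith
    simp only [map_add, map_smul, LinearIsometryEquiv.apply_symm_apply]
    rw [hxe, hs']
    module
  exact e ▸ hx.1

/-- Sections of bodies by all the hyperplanes through `ζ` determine the length of a diameter. -/
lemma chordSup_le_of_dirCong {K L : Set E4} (hK : IsCompact K) (ζ : E4) (hne : L.Nonempty)
    (hcong : ∀ w ∈ S2 ζ, DirCong w (sect w K) (sect w L)) : chordSup L ≤ chordSup K := by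
  obtain ⟨x, hx⟩ := hne
  refine csSup_le ⟨_, x, x, by simpa using hx, rfl⟩ ?_
  rintro _ ⟨z, y, hzy, rfl⟩
  obtain ⟨w, hw, hζw, hz, hy⟩ := exists_unit_orthogonal ζ z y
  obtain ⟨χ, -, a, -, h⟩ := hcong w ⟨hw, by rwa [real_inner_comm]⟩
  have := dist_le_chordSup hK (segment_subset_of_image_sect_eq_symm h hz hy hzy)
  rwa [χ.symm.dist_map, dist_add_right] at this

lemma starDiamDirs_countable {K : Set E4} (hK : CountablyManyDiamsStar K)
    (hpos : 0 < chordSup K) : (starDiamDirs K).Countable := by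
  refine (hK.image fun p => (dist p.1 p.2)⁻¹ • (p.2 - p.1)).mono ?_
  rintro θ ⟨hθ, z, y, h, hyz⟩
  refine ⟨(z, y), h, ?_⟩
  have : dist z y ≠ 0 := by rw [h.2]; exact hpos.ne'
  simp only [hyz, smul_smul, inv_mul_cancel₀ this, one_smul]

lemma IsDiamStar.mem_starDiamDirs {K : Set E4} {z y v : E4} (h : IsDiamStar K z y)
    (hv : v ∈ sph) {s : ℝ} (hs : s ≠ 0) (hyz : y - z = s • v) : v ∈ starDiamDirs K := by
  have hd : dist z y = |s| := by
    have hv1 : ‖v‖ = 1 := by simpa [sph] using hv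
    rw [dist_comm, dist_eq_norm, hyz, norm_smul, hv1, mul_one, Real.norm_eq_abs]
  rcases hs.lt_or_gt with hs | hs
  · refine ⟨hv, y, z, h.symm, ?_⟩
    rw [dist_comm, hd, abs_of_neg hs, neg_smul, ← hyz, neg_sub]
  · refine ⟨hv, z, y, h, ?_⟩
    rw [hd, abs_of_pos hs, hyz]

lemma exists_smul_eq_of_zero_mem_segment {z y v : E4} {s : ℝ} (h0 : (0 : E4) ∈ segment ℝ z y)
    (hyz : y - z = s • v) : ∃ a : ℝ, z = a • v ∧ y = (a + s) • v := by
  obtain ⟨p, q, -, -, hpq, h⟩ := h0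
  have hy : y = z + s • v := by rw [← hyz]; abel
  have hp : p = 1 - q := by linarith
  have hz : z = (-(q * s)) • v := by
    have : p • z + q • y = z + (q * s) • v := by rw [hy, hp]; module
    rw [this] at h
    rw [neg_smul]; exact eq_neg_of_add_eq_zero_left h
  exact ⟨-(q * s), hz, by rw [hy, hz]; module⟩

lemma zero_mem_segment_smul {v : E4} {a b : ℝ} (ha : a ≤ 0) (hb : 0 ≤ b) :
    (0 : E4) ∈ segment ℝ (a • v) (b • v) := by
  have h : (0 : ℝ) ∈ segment ℝ a b := by
    rw [segment_eq_Icc (ha.trans hb)]; exact ⟨ha, hb⟩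
  obtain ⟨p, q, hp, hq, hpq, e⟩ := h
  refine ⟨p, q, hp, hq, hpq, ?_⟩
  rw [smul_smul, smul_smul, ← add_smul]
  rw [smul_eq_mul, smul_eq_mul] at e
  rw [e, zero_smul]

/-- Lemma: `L` has a diameter through the origin parallel to `ζ`,
`Ω^r` is dense in `S²(ζ)`, the congruence rotations map `ζ` to `±ζ`, `v_K(ζ) = v_L(ζ)`. -/
theorem stmt_15 (K L : Set E4) (hK : IsStarBody K) (hL : IsStarBody L)
    (hKc : CountablyManyDiamsStar K) (hLc : CountablyManyDiamsStar L)
    (ζ : E4) (hζ : ζ ∈ sph)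
    (hd : ∃ z y : E4, IsDiamStar K z y ∧ (0 : E4) ∈ segment ℝ z y ∧
      ∃ s : ℝ, s ≠ 0 ∧ y - z = s • ζ)
    (hcong : ∀ w ∈ S2 ζ, DirCong w (sect w K) (sect w L))
    (hsym : ∀ w ∈ S2 ζ,
      (¬ HasPiSymSet w ζ (sect w K) ∧ ¬ HasPiSymSet w ζ (sect w L)) ∧
      ∀ u ∈ S2 ζ ∩ S2 w, ¬ HasPiSymSet w u (sect w K) ∧ ¬ HasPiSymSet w u (sect w L)) :
    (∃ z y : E4, IsDiamStar L z y ∧ (0 : E4) ∈ segment ℝ z y ∧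
      ∃ s : ℝ, s ≠ 0 ∧ y - z = s • ζ) ∧
    S2 ζ ⊆ closure (OmegaR K L ζ) ∧
    (∀ w ∈ OmegaR K L ζ, ∀ (χ : E4 ≃ₗᵢ[ℝ] E4) (a : E4), IsRot w χ → ⟪a, w⟫ = 0 →
      χ '' (sect w K) = (fun x => x + a) '' (sect w L) → (χ ζ = ζ ∨ χ ζ = -ζ)) ∧
    radialFn K ζ + radialFn K (-ζ) = radialFn L ζ + radialFn L (-ζ) := by
  obtain ⟨z, y, hzy, h0, s, hs, hyz⟩ := hd
  have hζ1 : ‖ζ‖ = 1 := by simpa [sph] using hζ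
  obtain ⟨a, rfl, rfl⟩ := exists_smul_eq_of_zero_mem_segment h0 hyz
  have hpos : 0 < chordSup K := by
    rw [← hzy.2, dist_comm, dist_eq_norm, hyz, norm_smul, hζ1, mul_one]
    exact norm_pos_iff.2 hs
  have hζS : ∀ w ∈ S2 ζ, ⟪ζ, w⟫ = 0 := fun w hw => by rw [real_inner_comm]; exact hw.2
  have hmul : ∀ w ∈ S2 ζ, ∀ c : ℝ, ⟪c • ζ, w⟫ = 0 := fun w hw c => by
    rw [real_inner_smul_left, hζS w hw, mul_zero]
  -- every congruence carries the diameter of `K` along `ζ` to a segment in `L`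
  have htrans : ∀ w ∈ S2 ζ, ∀ (χ : E4 ≃ₗᵢ[ℝ] E4) (c : E4),
      χ '' sect w K = (fun x => x + c) '' sect w L →
      segment ℝ (χ (a • ζ) - c) (χ ((a + s) • ζ) - c) ⊆ L ∧
        dist (χ (a • ζ) - c) (χ ((a + s) • ζ) - c) = chordSup K := fun w hw χ c h =>
    ⟨segment_subset_of_image_sect_eq h (hmul w hw _) (hmul w hw _) hzy.1,
      by rw [dist_sub_right, χ.dist_map, hzy.2]⟩
  obtain ⟨w₀, hw₀, hw₀ζ, -, -⟩ := exists_unit_orthogonal ζ 0 0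
  have hw₀S : w₀ ∈ S2 ζ := ⟨hw₀, by rwa [real_inner_comm]⟩
  have hKL : chordSup L = chordSup K := by
    refine le_antisymm
      (chordSup_le_of_dirCong hK.1.1 ζ (hL.1.2.1.mono interior_subset) hcong) ?_
    obtain ⟨χ, -, c, -, h⟩ := hcong w₀ hw₀S
    obtain ⟨hsub, hdist⟩ := htrans w₀ hw₀S χ c h
    exact hdist ▸ dist_le_chordSup hL.1.1 hsub
  have htransL : ∀ w ∈ S2 ζ, ∀ (χ : E4 ≃ₗᵢ[ℝ] E4) (c : E4),
      χ '' sect w K = (fun x => x + c) '' sect w L →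
      IsDiamStar L (χ (a • ζ) - c) (χ ((a + s) • ζ) - c) := fun w hw χ c h =>
    ⟨(htrans w hw χ c h).1, (htrans w hw χ c h).2.trans hKL.symm⟩
  have hposL : 0 < chordSup L := hKL ▸ hpos
  -- by countability, some section of `L` only contains diameters on the line through `ζ`
  obtain ⟨p, q, hpq⟩ : ∃ p q : ℝ, IsDiamStar L (p • ζ) (q • ζ) := by
    let T : Set E4 := {x | (∃ y, IsDiamStar L x y) ∧ x ≠ ⟪x, ζ⟫ • ζ}
    have hT : T.Countable := by
      refine (hLc.image Prod.fst).mono ?_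
      rintro x ⟨⟨y, hy⟩, -⟩
      exact ⟨(x, y), hy, rfl⟩
    obtain ⟨w, hw, hwT⟩ := closure_nonempty_iff.1
      ⟨w₀, S2_subset_closure_inner_ne_zero hζ1 hT (fun x hx => hx.2) hw₀S⟩
    obtain ⟨χ, hχ, c, hc, h⟩ := hcong w hw
    have hD := htransL w hw χ c h
    have hline : ∀ r : ℝ, (∃ y, IsDiamStar L (χ (r • ζ) - c) y) →
        χ (r • ζ) - c = ⟪χ (r • ζ) - c, ζ⟫ • ζ := by
      intro r hr
      by_contra hne
      refine hwT _ ⟨hr, hne⟩ ?_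
      rw [real_inner_comm, inner_sub_left, hχ.inner_apply, hmul w hw, hc, sub_zero]
    have e1 := hline a ⟨_, hD⟩
    have e2 := hline (a + s) ⟨_, hD.symm⟩
    rw [e1, e2] at hD
    exact ⟨_, _, hD⟩
  refine ⟨?_, ?_, ?_, ?_⟩
  · have hne : q - p ≠ 0 := by
      intro h
      have : q = p := by linarith
      rw [← hpq.2, this, dist_self] at hposL
      exact hposL.false
    rcases hpq.exists_radial hL.1.1 hL.2.1 hζ1 with h | h
    · exact ⟨_, _, hpq, zero_mem_segment_smul h.1 h.2, q - p, hne, by module⟩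
    · exact ⟨_, _, hpq.symm, zero_mem_segment_smul h.1 h.2, -(q - p), neg_ne_zero.2 hne,
        by module⟩
  · let A := starDiamDirs K ∪ starDiamDirs L
    have hA : (A \ {ζ, -ζ}).Countable :=
      ((starDiamDirs_countable hKc hpos).union (starDiamDirs_countable hLc hposL)).mono
        Set.sdiff_subset
    have hAne : ∀ θ ∈ A \ {ζ, -ζ}, θ ≠ ⟪θ, ζ⟫ • ζ := by
      rintro θ ⟨hθ, hθζ⟩ h
      have hθ1 : ‖θ‖ = 1 := by
        have : θ ∈ sph := hθ.elim And.left And.left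
        simpa [sph] using this
      have : |⟪θ, ζ⟫| = 1 := by
        have := congrArg norm h
        rwa [norm_smul, hζ1, hθ1, mul_one, Real.norm_eq_abs, eq_comm] at this
      rcases eq_or_eq_neg_of_abs_eq this with h1 | h1
      · exact hθζ (Or.inl (by rw [h, h1, one_smul]))
      · exact hθζ (Or.inr (by rw [Set.mem_singleton_iff, h, h1, neg_smul, one_smul]))
    refine (S2_subset_closure_inner_ne_zero hζ1 hA hAne).trans (closure_mono ?_)
    rintro w ⟨hw, hwA⟩
    refine ⟨hw, Set.Subset.antisymm ?_ ?_⟩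
    · rintro θ ⟨hθ, hθw⟩
      by_contra hne
      exact hwA θ ⟨hθ, hne⟩ (by rw [real_inner_comm]; exact hθw.2)
    · have hnζ : -ζ ∈ sph := by simpa [sph] using hζ1
      rintro θ (rfl | rfl)
      · exact ⟨Or.inl (hzy.mem_starDiamDirs hζ hs hyz), hζ, hζS w hw⟩
      · exact ⟨Or.inl (hzy.mem_starDiamDirs hnζ (neg_ne_zero.2 hs) (by rw [hyz]; module)),
          hnζ, by rw [inner_neg_left, hζS w hw, neg_zero]⟩
  · rintro w ⟨hw, hwA⟩ χ c hχ - h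
    have hχζ : χ ζ ∈ sph := by simpa [sph] using hζ1
    have hmem : χ ζ ∈ (starDiamDirs K ∪ starDiamDirs L) ∩ S2 w := by
      refine ⟨Or.inr ((htransL w hw χ c h).mem_starDiamDirs hχζ hs ?_), hχζ, ?_⟩
      · rw [map_smul, map_smul]; module
      · rw [hχ.inner_apply, hζS w hw]
    rw [hwA] at hmem
    exact hmem
  · rw [radialFn_add_eq_chordSup hK.1.1 hK.2.1 hζ1 hzy,
      radialFn_add_eq_chordSup hL.1.1 hL.2.1 hζ1 hpq, hKL]
end
end
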